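/- Fix an integer k ≥ 3, a k-vertex graph F and a constant η > 0 such that either (i) F is a tree on k vertices, or (ii) F = C_k with k ≥ 4 and η ≥ 1/k. Then for any γ, μ > 0 there exist α, ξ > 0 such that the following holds for all sufficiently large n ∈ ℕ: if G is an n-vertex graph with minimum degree δ(G) ≥ (η+μ)n and α*(G) ≤ αn, then G contains a ξ-absorbing set of size at most γn. -/

import Mathlib

open Finset

namespace RTT

variable {k n : ℕ}

/-- `S` spans a copy of the `k`-vertex graph `F` in `G`:
there is an injective graph homomorphism from `F` to `G` with image exactly `S`. -/
def SpansCopy (F : SimpleGraph (Fin k)) (G : SimpleGraph (Fin n))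
    (S : Finset (Fin n)) : Prop :=
  ∃ f : Fin k → Fin n, Function.Injective f ∧
    (∀ a b, F.Adj a b → G.Adj (f a) (f b)) ∧ Finset.image f Finset.univ = S

/-- `T` is an `F`-tiling in `G`: a collection of pairwise vertex-disjoint vertex sets,
each spanning a copy of `F`. -/
def IsTiling (F : SimpleGraph (Fin k)) (G : SimpleGraph (Fin n))
    (T : Finset (Finset (Fin n))) : Prop :=
  (∀ S ∈ T, SpansCopy F G S) ∧ ∀ S ∈ T, ∀ S' ∈ T, S ≠ S' → Disjoint S S'

/-- The induced subgraph of `G` on the vertex set `A` has a perfect `F`-tiling. -/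
def PerfTilingOn (F : SimpleGraph (Fin k)) (G : SimpleGraph (Fin n))
    (A : Finset (Fin n)) : Prop :=
  ∃ T : Finset (Finset (Fin n)), IsTiling F G T ∧ T.biUnion id = A

/-- The minimum degree of `G` is at least `x`. -/
def MinDegGE (G : SimpleGraph (Fin n)) (x : ℝ) : Prop :=
  ∀ v : Fin n, x ≤ ((G.neighborSet v).ncard : ℝ)

/-- The `r`-independence number of `G` is at most `x`: every vertex set whose induced
subgraph contains no copy of `K_r` has size at most `x`. -/
def IndepBound (G : SimpleGraph (Fin n)) (r : ℕ) (x : ℝ) : Prop :=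
  ∀ S : Finset (Fin n), (∀ T ⊆ S, ¬ G.IsNClique r T) → (S.card : ℝ) ≤ x

/-- `α*(G) ≤ x`: every bipartite hole of `G` has size at most `x`. -/
def HoleBound (G : SimpleGraph (Fin n)) (x : ℝ) : Prop :=
  ∀ (s : ℕ) (U₁ U₂ : Finset (Fin n)), Disjoint U₁ U₂ → U₁.card = s → U₂.card = s →
    (∀ u ∈ U₁, ∀ v ∈ U₂, ¬ G.Adj u v) → (s : ℝ) ≤ x

/-- `A` is a `ξ`-absorbing set with respect to `V'` (for the `k`-vertex graph `F`
in the `n`-vertex graph `G`). -/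
def IsAbsorbingSet (F : SimpleGraph (Fin k)) (G : SimpleGraph (Fin n)) (ξ : ℝ)
    (V' A : Finset (Fin n)) : Prop :=
  ∀ U : Finset (Fin n), U ⊆ V' \ A → (U.card : ℝ) ≤ ξ * n →
    k ∣ (A ∪ U).card → PerfTilingOn F G (A ∪ U)

/-- `A` is an `(F,t)`-absorber for the `k`-set `S`. -/
def IsAbsorber (F : SimpleGraph (Fin k)) (G : SimpleGraph (Fin n)) (t : ℕ)
    (S A : Finset (Fin n)) : Prop :=
  Disjoint A S ∧ A.card ≤ k ^ 2 * t ∧ PerfTilingOn F G A ∧ PerfTilingOn F G (A ∪ S)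

/-- `S` has a family of at least `x` pairwise vertex-disjoint `(F,t)`-absorbers in `G`. -/
def HasManyAbsorbers (F : SimpleGraph (Fin k)) (G : SimpleGraph (Fin n)) (t : ℕ)
    (S : Finset (Fin n)) (x : ℝ) : Prop :=
  ∃ 𝒜 : Finset (Finset (Fin n)), x ≤ (𝒜.card : ℝ) ∧
    (∀ A ∈ 𝒜, IsAbsorber F G t S A) ∧
    ∀ A ∈ 𝒜, ∀ A' ∈ 𝒜, A ≠ A' → Disjoint A A'

/-- `𝒮` is an `F`-fan at `v` in `U`: a collection of pairwise disjoint `(k-1)`-sets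
`S ⊆ U \ {v}` such that `{v} ∪ S` spans a copy of `F`; its size is `𝒮.card`. -/
def IsFan (F : SimpleGraph (Fin k)) (G : SimpleGraph (Fin n)) (v : Fin n)
    (U : Finset (Fin n)) (𝒮 : Finset (Finset (Fin n))) : Prop :=
  (∀ S ∈ 𝒮, S ⊆ U.erase v ∧ S.card = k - 1 ∧ SpansCopy F G (insert v S)) ∧
    ∀ S ∈ 𝒮, ∀ S' ∈ 𝒮, S ≠ S' → Disjoint S S'

/-- `u` and `v` are `(F, m, t)`-reachable in `G`. -/
def FReachable (F : SimpleGraph (Fin k)) (G : SimpleGraph (Fin n)) (m : ℝ) (t : ℕ)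
    (u v : Fin n) : Prop :=
  ∀ W : Finset (Fin n), (W.card : ℝ) ≤ m →
    ∃ S : Finset (Fin n), Disjoint S W ∧ u ∉ S ∧ v ∉ S ∧ S.card ≤ k * t - 1 ∧
      PerfTilingOn F G (insert u S) ∧ PerfTilingOn F G (insert v S)

/-- `U` is `(F, m, t)`-closed in `G`. -/
def FClosed (F : SimpleGraph (Fin k)) (G : SimpleGraph (Fin n)) (m : ℝ) (t : ℕ)
    (U : Finset (Fin n)) : Prop :=
  ∀ u ∈ U, ∀ v ∈ U, u ≠ v → FReachable F G m t u v

/-- `P` is a partition of the vertex set of an `n`-vertex graph into `C` parts. -/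
def IsPartition {C : ℕ} (P : Fin C → Finset (Fin n)) : Prop :=
  (∀ i j, i ≠ j → Disjoint (P i) (P j)) ∧ Finset.univ.biUnion P = Finset.univ

/-- The `k`-vector `v` is `(F, β)`-robust with respect to the partition `P`:
it has coordinate sum `k`, and avoiding any set `W` of at most `βn` vertices there is
a copy of `F` whose vertex set has index vector `v`. -/
def RobustVec (F : SimpleGraph (Fin k)) (G : SimpleGraph (Fin n)) {C : ℕ}
    (P : Fin C → Finset (Fin n)) (β : ℝ) (v : Fin C → ℕ) : Prop :=
  (∑ i, v i) = k ∧
    ∀ W : Finset (Fin n), (W.card : ℝ) ≤ β * n →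
      ∃ S : Finset (Fin n), Disjoint S W ∧ SpansCopy F G S ∧ ∀ i, (S ∩ P i).card = v i

end RTT

open Finset

namespace RTT

lemma perf_empty {k n : ℕ} (F : SimpleGraph (Fin k)) (G : SimpleGraph (Fin n)) :
    PerfTilingOn F G ∅ := ⟨∅, ⟨by simp, by simp⟩, by simp⟩

lemma perf_of_copy {k n : ℕ} {F : SimpleGraph (Fin k)} {G : SimpleGraph (Fin n)}
    {S : Finset (Fin n)} (h : SpansCopy F G S) : PerfTilingOn F G S :=
  ⟨{S}, ⟨by simpa using h, by simp⟩, by simp⟩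

lemma perf_union {k n : ℕ} {F : SimpleGraph (Fin k)} {G : SimpleGraph (Fin n)}
    {A B : Finset (Fin n)} (hA : PerfTilingOn F G A) (hB : PerfTilingOn F G B)
    (hd : Disjoint A B) : PerfTilingOn F G (A ∪ B) := by
  obtain ⟨T, ⟨h1, h2⟩, rfl⟩ := hA
  obtain ⟨T', ⟨h1', h2'⟩, rfl⟩ := hB
  have key : ∀ S ∈ T, ∀ S' ∈ T', Disjoint S S' := fun S hS S' hS' =>
    disjoint_of_subset_left (subset_biUnion_of_mem id hS)
      (disjoint_of_subset_right (subset_biUnion_of_mem id hS') hd)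
  refine ⟨T ∪ T', ⟨?_, ?_⟩, by rw [union_biUnion]⟩
  · intro S hS
    rcases mem_union.1 hS with h | h
    · exact h1 S h
    · exact h1' S h
  · intro S hS S' hS' hne
    rcases mem_union.1 hS with h | h <;> rcases mem_union.1 hS' with h' | h'
    · exact h2 S h S' h' hne
    · exact key S h S' h'
    · exact (key S' h' S h).symm
    · exact h2' S h S' h' hne

lemma perf_biUnion {k n : ℕ} {F : SimpleGraph (Fin k)} {G : SimpleGraph (Fin n)}
    {ι : Type*} [DecidableEq ι] (I : Finset ι) (f : ι → Finset (Fin n))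
    (h : ∀ i ∈ I, PerfTilingOn F G (f i))
    (hd : ∀ i ∈ I, ∀ j ∈ I, i ≠ j → Disjoint (f i) (f j)) :
    PerfTilingOn F G (I.biUnion f) := by
  induction I using Finset.induction_on with
  | empty => simpa using perf_empty F G
  | insert a s ha ih =>
    rw [biUnion_insert]
    apply perf_union (h a (mem_insert_self _ _))
    · apply ih
      · intro i hi; exact h i (mem_insert_of_mem hi)
      · intro i hi j hj; exact hd i (mem_insert_of_mem hi) j (mem_insert_of_mem hj)
    · rw [disjoint_biUnion_right]
      intro j hj
      apply hd a (mem_insert_self _ _) j (mem_insert_of_mem hj)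
      rintro rfl; exact ha hj

lemma perf_card {k n : ℕ} {F : SimpleGraph (Fin k)} {G : SimpleGraph (Fin n)}
    {A : Finset (Fin n)} (hA : PerfTilingOn F G A) : k ∣ A.card := by
  obtain ⟨T, ⟨h1, h2⟩, rfl⟩ := hA
  rw [card_biUnion (by intro S hS S' hS' hne; exact h2 S hS S' hS' hne)]
  apply Finset.dvd_sum
  intro S hS
  obtain ⟨f, hf, -, rfl⟩ := h1 S hS
  rw [id, card_image_of_injective _ hf]
  simp

/-- `S` switches `a` and `b`. -/
def Sw {k n : ℕ} (F : SimpleGraph (Fin k)) (G : SimpleGraph (Fin n)) (a b : Fin n)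
    (S : Finset (Fin n)) : Prop :=
  a ∉ S ∧ b ∉ S ∧ PerfTilingOn F G (insert a S) ∧ PerfTilingOn F G (insert b S)

lemma Sw.symm {k n : ℕ} {F : SimpleGraph (Fin k)} {G : SimpleGraph (Fin n)} {a b : Fin n}
    {S : Finset (Fin n)} (h : Sw F G a b S) : Sw F G b a S := ⟨h.2.1, h.1, h.2.2.2, h.2.2.1⟩

lemma Sw.trans {k n : ℕ} {F : SimpleGraph (Fin k)} {G : SimpleGraph (Fin n)} {a b c : Fin n}
    {S S' : Finset (Fin n)} (h : Sw F G a b S) (h' : Sw F G b c S') (hd : Disjoint S S')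
    (hab : a ≠ b) (hbc : b ≠ c) (ha : a ∉ S') (hc : c ∉ S) :
    Sw F G a c (insert b (S ∪ S')) := by
  obtain ⟨h1, h2, h3, h4⟩ := h
  obtain ⟨g1, g2, g3, g4⟩ := h'
  refine ⟨?_, ?_, ?_, ?_⟩
  · simp [hab, h1, ha]
  · simp [hbc.symm, g2, hc]
  · have : insert a (insert b (S ∪ S')) = insert a S ∪ insert b S' := by
      ext; simp <;> tauto
    rw [this]
    apply perf_union h3 g3
    simp [hd, ha, h2, hab.symm]
  · have : insert c (insert b (S ∪ S')) = insert b S ∪ insert c S' := by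
      ext; simp <;> tauto
    rw [this]
    apply perf_union h4 g4
    simp [hd, hc, g1, hbc.symm]

/-- Greedy selection of disjoint sets. -/
lemma greedy {V ι : Type*} [DecidableEq V] [DecidableEq ι] (I : Finset ι)
    (P : ι → Finset V → Prop) (W : Finset V) (m w : ℕ)
    (h : ∀ i ∈ I, ∀ W' : Finset V, W'.card ≤ w →
      ∃ S : Finset V, Disjoint S W' ∧ S.card ≤ m ∧ P i S)
    (hw : W.card + I.card * m ≤ w) :
    ∃ f : ι → Finset V, (∀ i ∈ I, Disjoint (f i) W ∧ (f i).card ≤ m ∧ P i (f i)) ∧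
      ∀ i ∈ I, ∀ j ∈ I, i ≠ j → Disjoint (f i) (f j) := by
  induction I using Finset.induction_on with
  | empty => exact ⟨fun _ => ∅, by simp, by simp⟩
  | insert a s ha ih =>
    rw [card_insert_of_notMem ha] at hw
    obtain ⟨f, hf1, hf2⟩ := ih (fun i hi => h i (mem_insert_of_mem hi)) (by nlinarith)
    have hc : (s.biUnion f).card ≤ s.card * m :=
      card_biUnion_le_card_mul _ _ _ (fun i hi => (hf1 i hi).2.1)
    obtain ⟨S, hS1, hS2, hS3⟩ := h a (mem_insert_self _ _) (W ∪ s.biUnion f) (by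
      have := card_union_le W (s.biUnion f)
      nlinarith)
    rw [disjoint_union_right, disjoint_biUnion_right] at hS1
    have hne : ∀ i ∈ s, i ≠ a := by rintro i hi rfl; exact ha hi
    refine ⟨Function.update f a S, ?_, ?_⟩
    · intro i hi
      rcases mem_insert.1 hi with rfl | hi
      · simpa using ⟨hS1.1, hS2, hS3⟩
      · rw [Function.update_of_ne (hne i hi)]; exact hf1 i hi
    · intro i hi j hj hij
      rcases mem_insert.1 hi with hi' | hi' <;> rcases mem_insert.1 hj with hj' | hj'
      · exact absurd (hi'.trans hj'.symm) hij
      · rw [hi', Function.update_self, Function.update_of_ne (hne j hj')]; exact hS1.2 j hj'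
      · rw [hj', Function.update_self, Function.update_of_ne (hne i hi')]
        exact (hS1.2 i hi').symm
      · rw [Function.update_of_ne (hne j hj'), Function.update_of_ne (hne i hi')]
        exact hf2 i hi' j hj' hij

/-- Every proper nonempty vertex subset has a vertex with at most one neighbour inside. -/
def Degen {k : ℕ} (F : SimpleGraph (Fin k)) : Prop :=
  ∀ T : Finset (Fin k), T.Nonempty → T ≠ univ →
    ∃ l ∈ T, ∀ y ∈ T, ∀ y' ∈ T, F.Adj l y → F.Adj l y' → y = y'

lemma tree_degen {k : ℕ} {F : SimpleGraph (Fin k)} (hF : F.IsTree) (T : Finset (Fin k))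
    (hT : T.Nonempty) : ∃ l ∈ T, ∀ y ∈ T, ∀ y' ∈ T, F.Adj l y → F.Adj l y' → y = y' := by
  obtain ⟨r, hr⟩ := hT
  obtain ⟨l, hl, hmax⟩ := exists_max_image T (fun v => F.dist r v) ⟨r, hr⟩
  refine ⟨l, hl, ?_⟩
  have key : ∀ y ∈ T, F.Adj l y → ∃ p : F.Walk r l, p.IsPath ∧ p.penultimate = y := by
    intro y hy hadj
    obtain ⟨q, hq, hql⟩ := hF.1.exists_path_of_dist r y
    have hd : F.dist r l = F.dist r y + 1 := by
      rcases hF.dist_eq_dist_add_one_of_adj r hadj with h | h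
      · exact h
      · have := hmax y hy
        omega
    refine ⟨q.concat hadj.symm, ?_, by simp⟩
    apply SimpleGraph.Walk.isPath_of_length_eq_dist
    simp [hql, hd]
  intro y hy y' hy' h h'
  obtain ⟨p, hp, hpy⟩ := key y hy h
  obtain ⟨p', hp', hpy'⟩ := key y' hy' h'
  have := hF.existsUnique_path r l
  rw [← hpy, ← hpy', this.unique hp hp']

open Fin.NatCast in
lemma cycle_degen {k : ℕ} (hk : 4 ≤ k) : Degen (SimpleGraph.cycleGraph k) := by
  obtain ⟨m, rfl⟩ : ∃ m, k = m + 2 := ⟨k - 2, by omega⟩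
  intro T hT hTu
  have : ∃ l ∈ T, l + 1 ∉ T := by
    by_contra hcon
    push Not at hcon
    apply hTu
    obtain ⟨r, hr⟩ := hT
    have h : ∀ j : ℕ, r + (j : Fin (m + 2)) ∈ T := by
      intro j
      induction j with
      | zero => simpa using hr
      | succ j ih => 
        have := hcon _ ih
        push_cast
        rwa [← add_assoc]
    ext v
    simp only [mem_univ, iff_true]
    have := h (v - r).val
    simpa using this
  obtain ⟨l, hl, hl1⟩ := this
  refine ⟨l, hl, ?_⟩
  have key : ∀ y ∈ T, (SimpleGraph.cycleGraph (m + 2)).Adj l y → y = l - 1 := by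
    intro y hy hadj
    rw [SimpleGraph.cycleGraph_adj] at hadj
    rcases hadj with h | h
    · rw [← h]; abel
    · exfalso; apply hl1; rw [← h]; simpa using hy
  intro y hy y' hy' h h'
  rw [key y hy h, key y' hy' h']

lemma good_of_hyp {k : ℕ} (hk : 3 ≤ k) {F : SimpleGraph (Fin k)}
    (h : F.IsTree ∨ (4 ≤ k ∧ F = SimpleGraph.cycleGraph k)) :
    Degen F ∧ ∃ x z : Fin k, x ≠ z ∧ ¬ F.Adj x z := by
  rcases h with h | ⟨h4, rfl⟩
  · refine ⟨fun T hT _ => tree_degen h T hT, ?_⟩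
    obtain ⟨l, -, hl⟩ := tree_degen h univ ⟨⟨0, by omega⟩, mem_univ _⟩
    by_contra hcon
    push Not at hcon
    obtain ⟨a, ha⟩ : ∃ a : Fin k, a ∉ ({l} : Finset (Fin k)) := by
      by_contra h; push Not at h
      have := card_le_card (fun x _ => h x : (univ : Finset (Fin k)) ⊆ {l})
      simp at this; omega
    obtain ⟨b, hb⟩ : ∃ b : Fin k, b ∉ ({l, a} : Finset (Fin k)) := by
      by_contra h; push Not at h
      have := card_le_card (fun x _ => h x : (univ : Finset (Fin k)) ⊆ {l, a})
      have h2 := card_le_two (a := l) (b := a)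
      simp at this; omega
    simp at ha hb
    exact hb.2 (hl b (mem_univ _) a (mem_univ _) (hcon _ _ (Ne.symm hb.1)) (hcon _ _ (Ne.symm ha)))
  · refine ⟨cycle_degen h4, ⟨0, by omega⟩, ⟨2, by omega⟩, by simp, ?_⟩
    rw [SimpleGraph.cycleGraph_adj']
    simp only [Fin.sub_def]
    rw [Nat.mod_eq_of_lt (by omega), Nat.mod_eq_sub_mod (by omega), Nat.mod_eq_of_lt (by omega)]
    omega

end RTT

open Finset

namespace RTT

/-- No bipartite hole of size `s`. -/
def NoHole {n : ℕ} (G : SimpleGraph (Fin n)) (s : ℕ) : Prop :=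
  ∀ U₁ U₂ : Finset (Fin n), Disjoint U₁ U₂ → s ≤ U₁.card → s ≤ U₂.card →
    ∃ u ∈ U₁, ∃ v ∈ U₂, G.Adj u v

lemma noHole_of_bound {n : ℕ} {G : SimpleGraph (Fin n)} {x : ℝ} (h : HoleBound G x) {s : ℕ}
    (hs : x < s) : NoHole G s := by
  intro U₁ U₂ hd h1 h2
  by_contra hcon
  push Not at hcon
  obtain ⟨A, hA, hA'⟩ := exists_subset_card_eq h1
  obtain ⟨B, hB, hB'⟩ := exists_subset_card_eq h2
  have := h s A B (disjoint_of_subset_left hA (disjoint_of_subset_right hB hd)) hA' hB'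
    (fun u hu v hv => hcon u (hA hu) v (hB hv))
  linarith

lemma embed_disj {k n s : ℕ} (F : SimpleGraph (Fin k)) {G : SimpleGraph (Fin n)}
    (hs : 1 ≤ s) (hG : NoHole G s) (v0 : Fin n) (m : ℕ) :
    ∀ T : Finset (Fin k), T.card = m →
    (∀ T' ⊆ T, T'.Nonempty → ∃ l ∈ T', ∀ y ∈ T', ∀ y' ∈ T', F.Adj l y → F.Adj l y' → y = y') →
    ∀ Y : Fin k → Finset (Fin n), (∀ y ∈ T, m * s ≤ (Y y).card) →
    (∀ y ∈ T, ∀ y' ∈ T, y ≠ y' → Disjoint (Y y) (Y y')) →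
    ∃ f : Fin k → Fin n, (∀ y ∈ T, f y ∈ Y y) ∧
      ∀ y ∈ T, ∀ y' ∈ T, F.Adj y y' → G.Adj (f y) (f y') := by
  classical
  induction m with
  | zero =>
    intro T hT _ Y _ _
    rw [card_eq_zero] at hT
    subst hT
    exact ⟨fun _ => v0, by simp, by simp⟩
  | succ m ih =>
    intro T hT hdeg Y hY hd
    obtain ⟨l, hl, hl'⟩ := hdeg T (Subset.refl _) (by rw [← card_pos]; omega)
    have hYl : s ≤ (Y l).card := le_trans (by nlinarith) (hY l hl)
    let Y' : Fin k → Finset (Fin n) := fun y =>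
      if F.Adj l y then (Y y).filter (fun a => ∃ b ∈ Y l, G.Adj a b) else Y y
    have hsub : ∀ y, Y' y ⊆ Y y := by
      intro y
      simp only [Y']
      split_ifs
      · exact filter_subset _ _
      · exact Subset.refl _
    obtain ⟨f, hf1, hf2⟩ := ih (T.erase l) (by rw [card_erase_of_mem hl]; omega)
      (fun T' hT' => hdeg T' (hT'.trans (erase_subset _ _))) Y' (by
        intro y hy
        have hyT := mem_of_mem_erase hy
        have hyl := ne_of_mem_erase hy
        have h1 := hY y hyT
        simp only [Y']
        split_ifs with hadj
        · have h2 := card_filter_add_card_filter_not (s := Y y) (fun a => ∃ b ∈ Y l, G.Adj a b)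
          have h3 : ((Y y).filter (fun a => ¬ ∃ b ∈ Y l, G.Adj a b)).card < s := by
            by_contra hcon
            rw [not_lt] at hcon
            obtain ⟨u, hu, v, hv, huv⟩ := hG _ (Y l)
              (disjoint_of_subset_left (filter_subset _ _) (hd y hyT l hl hyl)) hcon hYl
            rw [mem_filter] at hu
            exact hu.2 ⟨v, hv, huv⟩
          have : (m + 1) * s = m * s + s := by ring
          omega
        · have : (m + 1) * s = m * s + s := by ring
          omega) (by
        intro y hy y' hy' hne
        exact disjoint_of_subset_left (hsub y) (disjoint_of_subset_right (hsub y')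
          (hd y (mem_of_mem_erase hy) y' (mem_of_mem_erase hy') hne)))
    have hb : ∃ b ∈ Y l, ∀ y ∈ T.erase l, F.Adj l y → G.Adj (f y) b := by
      by_cases h : ∃ p ∈ T.erase l, F.Adj l p
      · obtain ⟨p, hp, hlp⟩ := h
        have := hf1 p hp
        simp only [Y', hlp, if_true, mem_filter] at this
        obtain ⟨-, b, hb, hadj⟩ := this
        refine ⟨b, hb, ?_⟩
        intro y hy hly
        rw [hl' y (mem_of_mem_erase hy) p (mem_of_mem_erase hp) hly hlp]
        exact hadj
      · push Not at h
        obtain ⟨b, hb⟩ : (Y l).Nonempty := by rw [← card_pos]; omega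
        exact ⟨b, hb, fun y hy hly => absurd hly (h y hy)⟩
    obtain ⟨b, hb, hb'⟩ := hb
    refine ⟨Function.update f l b, ?_, ?_⟩
    · intro y hy
      by_cases h : y = l
      · subst h; simpa using hb
      · rw [Function.update_of_ne h]
        exact hsub _ (hf1 y (mem_erase.2 ⟨h, hy⟩))
    · intro y hy y' hy' hadj
      by_cases h : y = l <;> by_cases h' : y' = l
      · subst h; subst h'; exact absurd hadj (F.loopless.irrefl _)
      · subst h
        rw [Function.update_self, Function.update_of_ne h']
        exact (hb' y' (mem_erase.2 ⟨h', hy'⟩) hadj).symm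
      · subst h'
        rw [Function.update_self, Function.update_of_ne h]
        exact hb' y (mem_erase.2 ⟨h, hy⟩) hadj.symm
      · rw [Function.update_of_ne h, Function.update_of_ne h']
        exact hf2 y (mem_erase.2 ⟨h, hy⟩) y' (mem_erase.2 ⟨h', hy'⟩) hadj

/-- A copy of `F` with `x` at `u`, the other vertices at prescribed sets. -/
lemma star_embed {k n s : ℕ} {F : SimpleGraph (Fin k)} {G : SimpleGraph (Fin n)}
    (hF : Degen F) (hs : 1 ≤ s) (hG : NoHole G s) (x : Fin k) (u : Fin n)
    (Y : Fin k → Finset (Fin n)) (W : Finset (Fin n))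
    (hY : ∀ y, y ≠ x → W.card + k * k * s + 1 ≤ (Y y).card)
    (hN : ∀ y, F.Adj x y → ∀ v ∈ Y y, G.Adj u v) :
    ∃ f : Fin k → Fin n, Function.Injective f ∧ (∀ a b, F.Adj a b → G.Adj (f a) (f b)) ∧
      f x = u ∧ ∀ y, y ≠ x → f y ∈ Y y ∧ f y ∉ W := by
  classical
  have hk : 1 ≤ k := by have := x.2; omega
  have hcard : (univ.erase x).card = k - 1 := by rw [card_erase_of_mem (mem_univ _)]; simp
  obtain ⟨Z, hZ1, hZ2⟩ := greedy (univ.erase x)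
    (fun y Z => Z ⊆ Y y ∧ Z.card = k * s) (insert u W) (k * s) (W.card + 1 + (k - 1) * (k * s))
    (by
      intro y hy W' hW'
      have h1 := hY y (ne_of_mem_erase hy)
      have h2 := le_card_sdiff W' (Y y)
      have h3 : k * k * s = (k - 1) * (k * s) + k * s := by
        obtain ⟨j, rfl⟩ : ∃ j, k = j + 1 := ⟨k - 1, by omega⟩
        simp; ring
      obtain ⟨Z, hZ, hZc⟩ := exists_subset_card_eq (s := Y y \ W') (n := k * s) (by omega)
      refine ⟨Z, ?_, hZc.le, hZ.trans sdiff_subset, hZc⟩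
      exact disjoint_of_subset_left hZ sdiff_disjoint)
    (by rw [hcard]; have := card_insert_le u W; omega)
  obtain ⟨f, hf1, hf2⟩ := embed_disj F hs hG u (k - 1) (univ.erase x) hcard
    (fun T' hT' hne => hF T' hne (by
      rintro rfl; have := hT' (mem_univ x); simp at this)) Z
    (by
      intro y hy
      rw [(hZ1 y hy).2.2.2]
      exact Nat.mul_le_mul_right _ (by omega)) hZ2
  have hE : ∀ y, y ≠ x → y ∈ univ.erase x := fun y hy => mem_erase.2 ⟨hy, mem_univ _⟩
  have hfu : ∀ y, y ≠ x → f y ≠ u ∧ f y ∉ W := by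
    intro y hy
    have := disjoint_left.1 (hZ1 y (hE y hy)).1 (hf1 y (hE y hy))
    simpa using this
  refine ⟨Function.update f x u, ?_, ?_, by simp, ?_⟩
  · intro a b hab
    by_cases ha : a = x <;> by_cases hb : b = x
    · rw [ha, hb]
    · rw [ha, Function.update_self, Function.update_of_ne hb] at hab
      exact absurd hab.symm (hfu b hb).1
    · rw [hb, Function.update_self, Function.update_of_ne ha] at hab
      exact absurd hab (hfu a ha).1
    · rw [Function.update_of_ne ha, Function.update_of_ne hb] at hab
      by_contra hne
      have := disjoint_left.1 (hZ2 a (hE a ha) b (hE b hb) hne) (hf1 a (hE a ha))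
      rw [hab] at this
      exact this (hf1 b (hE b hb))
  · intro a b hab
    by_cases ha : a = x <;> by_cases hb : b = x
    · rw [ha, hb] at hab; exact absurd hab (F.loopless.irrefl _)
    · rw [ha, Function.update_self, Function.update_of_ne hb]
      rw [ha] at hab
      exact hN b hab _ ((hZ1 b (hE b hb)).2.2.1 (hf1 b (hE b hb)))
    · rw [hb, Function.update_self, Function.update_of_ne ha]
      rw [hb] at hab
      exact (hN a hab.symm _ ((hZ1 a (hE a ha)).2.2.1 (hf1 a (hE a ha)))).symm
    · rw [Function.update_of_ne ha, Function.update_of_ne hb]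
      exact hf2 a (hE a ha) b (hE b hb) hab
  · intro y hy
    rw [Function.update_of_ne hy]
    exact ⟨(hZ1 y (hE y hy)).2.2.1 (hf1 y (hE y hy)), (hfu y hy).2⟩

end RTT

open Finset

namespace RTT

open Classical in
/-- Neighbourhood as a finset. -/
noncomputable def nb {n : ℕ} (G : SimpleGraph (Fin n)) (u : Fin n) : Finset (Fin n) :=
  univ.filter (fun v => G.Adj u v)

lemma mem_nb {n : ℕ} {G : SimpleGraph (Fin n)} {u v : Fin n} : v ∈ nb G u ↔ G.Adj u v := by
  simp [nb]

/-- Vertices with at least `t` common neighbours with `a`. -/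
noncomputable def Sim {n : ℕ} (G : SimpleGraph (Fin n)) (t : ℕ) (a : Fin n) : Finset (Fin n) :=
  univ.filter (fun b => t ≤ (nb G a ∩ nb G b).card)

lemma sim_symm {n : ℕ} {G : SimpleGraph (Fin n)} {t : ℕ} {a b : Fin n} (h : b ∈ Sim G t a) :
    a ∈ Sim G t b := by
  simp only [Sim, mem_filter, mem_univ, true_and] at h ⊢
  rwa [inter_comm]

/-- Working hypotheses. -/
structure Core {k n : ℕ} (F : SimpleGraph (Fin k)) (G : SimpleGraph (Fin n)) (s t : ℕ) :
    Prop where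
  degen : Degen F
  hxz : ∃ x z : Fin k, x ≠ z ∧ ¬ F.Adj x z
  hs : 1 ≤ s
  hole : NoHole G s
  hD : ∀ u, t ≤ (nb G u).card
  hS : ∀ u, t ≤ (Sim G t u).card
  hY : ∀ u, t ≤ (univ.filter (fun y => t ≤ (Sim G t y ∩ nb G u).card)).card

lemma Core.one_step {k n s t : ℕ} {F : SimpleGraph (Fin k)} {G : SimpleGraph (Fin n)}
    (C : Core F G s t) {a b : Fin n} (hab : b ∈ Sim G t a) (W : Finset (Fin n))
    (hW : W.card + k * k * s + 3 ≤ t) :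
    ∃ S : Finset (Fin n), Disjoint S W ∧ S.card ≤ k ∧ Sw F G a b S := by
  classical
  obtain ⟨x, -⟩ := C.hxz
  simp only [Sim, mem_filter, mem_univ, true_and] at hab
  obtain ⟨f, hf1, hf2, hf3, hf4⟩ := star_embed C.degen C.hs C.hole x a
    (fun _ => nb G a ∩ nb G b) (insert a (insert b W)) (by
      intro y _
      have h1 := card_insert_le a (insert b W)
      have h2 := card_insert_le b W
      omega) (by
      intro y _ v hv
      exact mem_nb.1 (mem_inter.1 hv).1)
  have hS : ∀ v ∈ (univ.erase x).image f, G.Adj b v ∧ v ≠ a ∧ v ≠ b ∧ v ∉ W := by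
    intro v hv
    obtain ⟨y, hy, rfl⟩ := mem_image.1 hv
    have := hf4 y (ne_of_mem_erase hy)
    refine ⟨mem_nb.1 (mem_inter.1 this.1).2, ?_⟩
    have h2 := this.2
    simp only [mem_insert, not_or] at h2
    exact h2
  have hb : ∀ y, y ≠ x → f y ≠ b := fun y hy =>
    (hS (f y) (mem_image_of_mem _ (mem_erase.2 ⟨hy, mem_univ _⟩))).2.2.1
  refine ⟨(univ.erase x).image f, ?_, ?_, ?_, ?_, ?_, ?_⟩
  · rw [disjoint_left]; intro v hv; exact (hS v hv).2.2.2
  · refine card_image_le.trans ((card_erase_le).trans ?_); simp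
  · intro h; exact (hS a h).2.1 rfl
  · intro h; exact (hS b h).2.2.1 rfl
  · apply perf_of_copy
    refine ⟨f, hf1, hf2, ?_⟩
    rw [← hf3, ← image_insert, insert_erase (mem_univ _)]
  · apply perf_of_copy
    refine ⟨Function.update f x b, ?_, ?_, ?_⟩
    · intro p q hpq
      by_cases hp : p = x <;> by_cases hq : q = x
      · rw [hp, hq]
      · rw [hp, Function.update_self, Function.update_of_ne hq] at hpq
        exact absurd hpq.symm (hb q hq)
      · rw [hq, Function.update_self, Function.update_of_ne hp] at hpq
        exact absurd hpq (hb p hp)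
      · rw [Function.update_of_ne hp, Function.update_of_ne hq] at hpq
        exact hf1 hpq
    · intro p q hpq
      by_cases hp : p = x <;> by_cases hq : q = x
      · rw [hp, hq] at hpq; exact absurd hpq (F.loopless.irrefl _)
      · rw [hp, Function.update_self, Function.update_of_ne hq]
        exact (hS _ (mem_image_of_mem _ (mem_erase.2 ⟨hq, mem_univ _⟩))).1
      · rw [hq, Function.update_self, Function.update_of_ne hp]
        exact (hS _ (mem_image_of_mem _ (mem_erase.2 ⟨hp, mem_univ _⟩))).1.symm
      · rw [Function.update_of_ne hp, Function.update_of_ne hq]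
        exact hf2 _ _ hpq
    · have : (univ : Finset (Fin k)).image (Function.update f x b)
          = (insert x (univ.erase x)).image (Function.update f x b) := by
        rw [insert_erase (mem_univ x)]
      rw [this, image_insert, Function.update_self]
      congr 1
      · apply image_congr
        intro y hy
        exact Function.update_of_ne (ne_of_mem_erase hy) _ _

lemma half {k n : ℕ} {F : SimpleGraph (Fin k)} {G : SimpleGraph (Fin n)} {f g : Fin k → Fin n}
    (hf1 : Function.Injective f) (hf2 : ∀ a b, F.Adj a b → G.Adj (f a) (f b))
    (I : Finset (Fin k)) (E : Fin k → Finset (Fin n))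
    (hE : ∀ i ∈ I, PerfTilingOn F G (insert (g i) (E i)))
    (hg : ∀ i ∈ I, ∀ j ∈ I, i ≠ j → g i ≠ g j)
    (hfg : ∀ i, ∀ j ∈ I, f i ≠ g j)
    (hfE : ∀ i, ∀ j ∈ I, f i ∉ E j)
    (hgE : ∀ i ∈ I, ∀ j ∈ I, g i ∉ E j)
    (hEE : ∀ i ∈ I, ∀ j ∈ I, i ≠ j → Disjoint (E i) (E j)) :
    PerfTilingOn F G (univ.image f ∪ I.biUnion (fun i => insert (g i) (E i))) := by
  classical
  apply perf_union
  · exact perf_of_copy ⟨f, hf1, hf2, rfl⟩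
  · apply perf_biUnion _ _ hE
    intro i hi j hj hij
    simp only [disjoint_insert_left, disjoint_insert_right, mem_insert, not_or]
    exact ⟨⟨(hg i hi j hj hij).symm, hgE j hj i hi⟩, hgE i hi j hj, hEE i hi j hj hij⟩
  · rw [disjoint_biUnion_right]
    intro j hj
    rw [disjoint_left]
    intro v hv
    obtain ⟨i, -, rfl⟩ := mem_image.1 hv
    simp only [mem_insert, not_or]
    exact ⟨hfg i j hj, hfE i j hj⟩

end RTT

open Finset

namespace RTT

lemma Core.mid {k n s t : ℕ} {F : SimpleGraph (Fin k)} {G : SimpleGraph (Fin n)}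
    (C : Core F G s t) (Z₁ Z₂ : Finset (Fin n)) (hZ₁ : t ≤ Z₁.card) (hZ₂ : t ≤ Z₂.card)
    (W : Finset (Fin n)) (hW : W.card + k * k * s + 20 * (k * k) ≤ t) :
    ∃ z₁ ∈ Z₁, ∃ z₂ ∈ Z₂, z₁ ∉ W ∧ z₂ ∉ W ∧ z₁ ≠ z₂ ∧
      ∃ S : Finset (Fin n), Disjoint S W ∧ S.card ≤ 6 * (k * k) ∧ Sw F G z₁ z₂ S := by
  classical
  obtain ⟨x, z, hxz, hnadj⟩ := C.hxz
  have hk : 1 ≤ k := by have := x.2; omega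
  have hkk : k ≤ k * k := by nlinarith
  obtain ⟨u, hu⟩ : (Z₁ \ W).Nonempty := by
    rw [← card_pos]; have := le_card_sdiff W Z₁; omega
  have huW : u ∉ W := (mem_sdiff.1 hu).2
  have hc0 := card_insert_le u W
  obtain ⟨T, hT, hTc⟩ := exists_subset_card_eq
    (s := univ.filter (fun y => t ≤ (Sim G t y ∩ nb G u).card) \ insert u W) (n := k) (by
      have := le_card_sdiff (insert u W) (univ.filter (fun y => t ≤ (Sim G t y ∩ nb G u).card))
      have := C.hY u
      omega)
  let y : Fin k → Fin n := fun i => ((T.equivFinOfCardEq hTc).symm i : Fin n)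
  have hyinj : Function.Injective y := by
    intro i j hij
    exact (T.equivFinOfCardEq hTc).symm.injective (Subtype.ext hij)
  have hyT : ∀ i, y i ∈ T := fun i => ((T.equivFinOfCardEq hTc).symm i).2
  have hy1 : ∀ i, t ≤ (Sim G t (y i) ∩ nb G u).card := by
    intro i
    have := (mem_sdiff.1 (hT (hyT i))).1
    simpa using this
  have hy2 : ∀ i, y i ∉ insert u W := fun i => (mem_sdiff.1 (hT (hyT i))).2
  have himg : ∀ h : Fin k → Fin n, (univ.image h).card ≤ k := by
    intro h; refine card_image_le.trans ?_; simp
  set W1 := insert u W ∪ univ.image y with hW1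
  have hc1 : W1.card ≤ W.card + 1 + k := by
    rw [hW1]; have := card_union_le (insert u W) (univ.image y); have := himg y; omega
  have emb : ∀ (Z W' : Finset (Fin n)), t ≤ Z.card → W'.card ≤ W.card + 1 + 3 * k →
      ∃ f : Fin k → Fin n, Function.Injective f ∧ (∀ a b, F.Adj a b → G.Adj (f a) (f b)) ∧
      f x = u ∧ f z ∈ Z ∧ (∀ i, i ≠ x → i ≠ z → f i ∈ Sim G t (y i)) ∧
      ∀ i, i ≠ x → f i ∉ W' := by
    intro Z W' hZ hW'
    obtain ⟨f, h1, h2, h3, h4⟩ := star_embed C.degen C.hs C.hole x u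
      (fun i => if i = z then Z else Sim G t (y i) ∩ nb G u) W' (by
        intro i _
        have := hy1 i
        split_ifs <;> omega) (by
        intro i hi v hv
        have : i ≠ z := by rintro rfl; exact hnadj hi
        simp only [this, if_false] at hv
        exact mem_nb.1 (mem_inter.1 hv).2)
    refine ⟨f, h1, h2, h3, ?_, ?_, fun i hi => (h4 i hi).2⟩
    · simpa using (h4 z hxz.symm).1
    · intro i hi hi'
      have := (h4 i hi).1
      simp only [hi', if_false] at this
      exact (mem_inter.1 this).1
  obtain ⟨f, hf1, hf2, hf3, hf4, hf5, hf6⟩ := emb Z₁ W1 hZ₁ (by omega)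
  set W2 := W1 ∪ univ.image f with hW2
  have hc2 : W2.card ≤ W.card + 1 + 2 * k := by
    rw [hW2]; have := card_union_le W1 (univ.image f); have := himg f; omega
  obtain ⟨g, hg1, hg2, hg3, hg4, hg5, hg6⟩ := emb Z₂ W2 hZ₂ (by omega)
  set W3 := W2 ∪ univ.image g with hW3
  have hc3 : W3.card ≤ W.card + 1 + 3 * k := by
    rw [hW3]; have := card_union_le W2 (univ.image g); have := himg g; omega
  have mW : ∀ v ∈ W, v ∈ W3 := by intro v hv; simp [hW3, hW2, hW1, hv]
  have mu : u ∈ W3 := by simp [hW3, hW2, hW1]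
  have my : ∀ i, y i ∈ W3 := by intro i; simp [hW3, hW2, hW1]
  have mf : ∀ i, f i ∈ W3 := by intro i; simp [hW3, hW2]
  have mg : ∀ i, g i ∈ W3 := by intro i; simp [hW3]
  have hfy : ∀ i j, i ≠ x → f i ≠ y j := by
    intro i j hi h; apply hf6 i hi; rw [h]; simp [hW1]
  have hgy : ∀ i j, i ≠ x → g i ≠ y j := by
    intro i j hi h; apply hg6 i hi; rw [h]; simp [hW2, hW1]
  have hgf : ∀ i j, i ≠ x → g i ≠ f j := by
    intro i j hi h; apply hg6 i hi; rw [h]; simp [hW2]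
  have huy : ∀ j, u ≠ y j := by
    intro j h; apply hy2 j; rw [← h]; simp
  have hfW : ∀ i, f i ∉ W := by
    intro i h
    by_cases hi : i = x
    · rw [hi, hf3] at h; exact huW h
    · apply hf6 i hi; simp [hW1, h]
  have hgW : ∀ i, g i ∉ W := by
    intro i h
    by_cases hi : i = x
    · rw [hi, hg3] at h; exact huW h
    · apply hg6 i hi; simp [hW2, hW1, h]
  set I : Finset (Fin k) := univ.filter (fun i => i ≠ x ∧ i ≠ z) with hI
  have mI : ∀ i, i ∈ I ↔ i ≠ x ∧ i ≠ z := by intro i; simp [hI]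
  have hIc : I.card ≤ k := by
    have := card_le_univ I; simpa using this
  obtain ⟨Sf, hSf1, hSf2⟩ := greedy (I ×ˢ (univ : Finset Bool))
    (fun p S => if p.2 then Sw F G (f p.1) (y p.1) S else Sw F G (y p.1) (g p.1) S)
    W3 k (W3.card + 2 * (k * k)) (by
      rintro ⟨i, b⟩ hi W' hW'
      have hi' := (mI i).1 (mem_product.1 hi).1
      cases b
      · obtain ⟨S, h1, h2, h3⟩ := C.one_step (hg5 i hi'.1 hi'.2) W' (by omega)
        exact ⟨S, h1, h2, by simpa using h3⟩
      · obtain ⟨S, h1, h2, h3⟩ := C.one_step (hf5 i hi'.1 hi'.2) W' (by omega)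
        exact ⟨S, h1, h2, by simpa using h3.symm⟩) (by
      rw [card_product]
      simp only [card_univ, Fintype.card_bool]
      nlinarith)
  have mA : ∀ i ∈ I, (i, true) ∈ I ×ˢ (univ : Finset Bool) := by intro i hi; simp [hi]
  have mB : ∀ i ∈ I, (i, false) ∈ I ×ˢ (univ : Finset Bool) := by intro i hi; simp [hi]
  have nA : ∀ i ∈ I, ∀ v ∈ W3, v ∉ Sf (i, true) := fun i hi v hv h =>
    disjoint_left.1 (hSf1 _ (mA i hi)).1 h hv
  have nB : ∀ i ∈ I, ∀ v ∈ W3, v ∉ Sf (i, false) := fun i hi v hv h =>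
    disjoint_left.1 (hSf1 _ (mB i hi)).1 h hv
  let E : Fin k → Finset (Fin n) := fun i => insert (y i) (Sf (i, true) ∪ Sf (i, false))
  have hE : ∀ i ∈ I, Sw F G (f i) (g i) (E i) := by
    intro i hi
    have h1 := (hSf1 _ (mA i hi)).2.2
    have h2 := (hSf1 _ (mB i hi)).2.2
    simp only [if_true] at h1
    simp only [Bool.false_eq_true, if_false] at h2
    exact h1.trans h2 (hSf2 _ (mA i hi) _ (mB i hi) (by simp)) (hfy i i ((mI i).1 hi).1)
      (hgy i i ((mI i).1 hi).1).symm (nB i hi _ (mf i)) (nA i hi _ (mg i))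
  have hEc : ∀ i ∈ I, (E i).card ≤ 2 * k + 1 := by
    intro i hi
    have h1 := card_insert_le (y i) (Sf (i, true) ∪ Sf (i, false))
    have h2 := card_union_le (Sf (i, true)) (Sf (i, false))
    have h3 := (hSf1 _ (mA i hi)).2.1
    have h4 := (hSf1 _ (mB i hi)).2.1
    simp only [E]; omega
  have nE : ∀ i ∈ I, ∀ v ∈ W3, (∀ j, v ≠ y j) → v ∉ E i := by
    intro i hi v hv hvy
    simp only [E, mem_insert, mem_union, not_or]
    exact ⟨hvy i, nA i hi v hv, nB i hi v hv⟩
  have hEE : ∀ i ∈ I, ∀ j ∈ I, i ≠ j → Disjoint (E i) (E j) := by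
    intro i hi j hj hij
    have a1 : y j ≠ y i := fun h => hij (hyinj h).symm
    have a2 := nA _ hi _ (my j)
    have a3 := nB _ hi _ (my j)
    have a4 := nA _ hj _ (my i)
    have a5 := nB _ hj _ (my i)
    have a6 := hSf2 _ (mA i hi) _ (mA j hj) (by simp [hij])
    have a7 := hSf2 _ (mA i hi) _ (mB j hj) (by simp)
    have a8 := hSf2 _ (mB i hi) _ (mA j hj) (by simp)
    have a9 := hSf2 _ (mB i hi) _ (mB j hj) (by simp [hij])
    simp only [E, disjoint_insert_left, disjoint_insert_right, disjoint_union_left,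
      disjoint_union_right, mem_insert, mem_union, not_or]
    tauto
  have hfE : ∀ i, ∀ j ∈ I, f i ∉ E j := by
    intro i j hj
    apply nE j hj _ (mf i)
    intro l
    by_cases hi : i = x
    · rw [hi, hf3]; exact huy l
    · exact hfy i l hi
  have hgE : ∀ i, ∀ j ∈ I, g i ∉ E j := by
    intro i j hj
    apply nE j hj _ (mg i)
    intro l
    by_cases hi : i = x
    · rw [hi, hg3]; exact huy l
    · exact hgy i l hi
  have P1 := half (g := g) hf1 hf2 I E (fun i hi => (hE i hi).2.2.2)
    (fun i _ j _ hij h => hij (hg1 h)) (fun i j hj h => hgf j i ((mI j).1 hj).1 h.symm) hfE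
    (fun i _ => hgE i) hEE
  have P2 := half (g := f) hg1 hg2 I E (fun i hi => (hE i hi).2.2.1)
    (fun i _ j _ hij h => hij (hf1 h)) (fun i j hj h => by
      by_cases hi : i = x
      · rw [hi, hg3, ← hf3] at h
        exact ((mI j).1 hj).1 (hf1 h).symm
      · exact hgf i j hi h) hgE
    (fun i _ => hfE i) hEE
  refine ⟨f z, hf4, g z, hg4, hfW z, hgW z, (hgf z z hxz.symm).symm,
    insert u (I.image f ∪ I.image g ∪ I.biUnion E), ?_, ?_, ?_, ?_, ?_, ?_⟩
  · rw [disjoint_left]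
    intro v hv hvW
    simp only [mem_insert, mem_union, mem_image, mem_biUnion] at hv
    rcases hv with rfl | (⟨i, -, rfl⟩ | ⟨i, -, rfl⟩) | ⟨i, hi, hvi⟩
    · exact huW hvW
    · exact hfW i hvW
    · exact hgW i hvW
    · exact nE i hi v (mW v hvW) (by rintro j rfl; exact hy2 j (mem_insert_of_mem hvW)) hvi
  · have h1 := card_insert_le u (I.image f ∪ I.image g ∪ I.biUnion E)
    have h2 := card_union_le (I.image f ∪ I.image g) (I.biUnion E)
    have h3 := card_union_le (I.image f) (I.image g)
    have h4 : (I.image f).card ≤ k := card_image_le.trans hIc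
    have h5 : (I.image g).card ≤ k := card_image_le.trans hIc
    have h6 : (I.biUnion E).card ≤ I.card * (2 * k + 1) := card_biUnion_le_card_mul _ _ _ hEc
    have h7 : I.card * (2 * k + 1) ≤ k * (2 * k + 1) := Nat.mul_le_mul_right _ hIc
    nlinarith
  · simp only [mem_insert, mem_union, mem_image, mem_biUnion, not_or, not_exists, not_and]
    refine ⟨fun h => hxz (hf1 (hf3.trans h.symm)), ⟨?_, ?_⟩, fun i hi => hfE z i hi⟩
    · intro i hi h; exact ((mI i).1 hi).2 (hf1 h)
    · intro i hi h; exact hgf i z ((mI i).1 hi).1 h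
  · simp only [mem_insert, mem_union, mem_image, mem_biUnion, not_or, not_exists, not_and]
    refine ⟨fun h => hxz (hg1 (hg3.trans h.symm)), ⟨?_, ?_⟩, fun i hi => hgE z i hi⟩
    · intro i hi h; exact hgf z i hxz.symm h.symm
    · intro i hi h; exact ((mI i).1 hi).2 (hg1 h)
  · convert P1 using 1
    ext v
    simp only [mem_insert, mem_union, mem_image, mem_biUnion, mem_univ, true_and]
    constructor
    · rintro (rfl | rfl | (⟨i, hi, rfl⟩ | ⟨i, hi, rfl⟩) | ⟨i, hi, hv⟩)
      · exact Or.inl ⟨z, rfl⟩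
      · exact Or.inl ⟨x, hf3⟩
      · exact Or.inl ⟨i, rfl⟩
      · exact Or.inr ⟨i, hi, Or.inl rfl⟩
      · exact Or.inr ⟨i, hi, Or.inr hv⟩
    · rintro (⟨i, rfl⟩ | ⟨i, hi, rfl | hv⟩)
      · by_cases h1 : i = x
        · rw [h1, hf3]; simp
        · by_cases h2 : i = z
          · rw [h2]; simp
          · exact Or.inr (Or.inr (Or.inl (Or.inl ⟨i, (mI i).2 ⟨h1, h2⟩, rfl⟩)))
      · exact Or.inr (Or.inr (Or.inl (Or.inr ⟨i, hi, rfl⟩)))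
      · exact Or.inr (Or.inr (Or.inr ⟨i, hi, hv⟩))
  · convert P2 using 1
    ext v
    simp only [mem_insert, mem_union, mem_image, mem_biUnion, mem_univ, true_and]
    constructor
    · rintro (rfl | rfl | (⟨i, hi, rfl⟩ | ⟨i, hi, rfl⟩) | ⟨i, hi, hv⟩)
      · exact Or.inl ⟨z, rfl⟩
      · exact Or.inl ⟨x, hg3⟩
      · exact Or.inr ⟨i, hi, Or.inl rfl⟩
      · exact Or.inl ⟨i, rfl⟩
      · exact Or.inr ⟨i, hi, Or.inr hv⟩
    · rintro (⟨i, rfl⟩ | ⟨i, hi, rfl | hv⟩)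
      · by_cases h1 : i = x
        · rw [h1, hg3]; simp
        · by_cases h2 : i = z
          · rw [h2]; simp
          · exact Or.inr (Or.inr (Or.inl (Or.inr ⟨i, (mI i).2 ⟨h1, h2⟩, rfl⟩)))
      · exact Or.inr (Or.inr (Or.inl (Or.inl ⟨i, hi, rfl⟩)))
      · exact Or.inr (Or.inr (Or.inr ⟨i, hi, hv⟩))

lemma Core.reach {k n s t : ℕ} {F : SimpleGraph (Fin k)} {G : SimpleGraph (Fin n)}
    (C : Core F G s t) (u v : Fin n)
    (W : Finset (Fin n)) (hW : W.card + k * k * s + 40 * (k * k) ≤ t) :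
    ∃ S : Finset (Fin n), Disjoint S W ∧ S.card ≤ 10 * (k * k) ∧ Sw F G u v S := by
  classical
  have hk : 1 ≤ k := by obtain ⟨x, -⟩ := C.hxz; have := x.2; omega
  have hkk : k ≤ k * k := by nlinarith
  have c1 := card_insert_le u (insert v W)
  have c2 := card_insert_le v W
  obtain ⟨z₁, hz₁, z₂, hz₂, hW1, hW2, hne, S, hS1, hS2, hS3⟩ :=
    C.mid (Sim G t u) (Sim G t v) (C.hS u) (C.hS v) (insert u (insert v W)) (by omega)
  set W' := insert z₁ (insert z₂ (insert u (insert v W) ∪ S)) with hW'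
  have c3 : W'.card ≤ _ := card_insert_le z₁ (insert z₂ (insert u (insert v W) ∪ S))
  have c4 := card_insert_le z₂ (insert u (insert v W) ∪ S)
  have c5 := card_union_le (insert u (insert v W)) S
  obtain ⟨S1, hA1, hA2, hA3⟩ := C.one_step hz₁ W' (by omega)
  have c6 := card_union_le W' S1
  obtain ⟨S2, hB1, hB2, hB3⟩ := C.one_step (sim_symm hz₂) (W' ∪ S1) (by omega)
  simp only [hW', disjoint_insert_right, disjoint_union_right] at hA1 hB1 hS1
  simp only [mem_insert, not_or] at hW1 hW2
  have T1 := hA3.trans hS3 hA1.2.2.2 (Ne.symm hW1.1) hne hS1.1 hA1.2.1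
  have T2 := T1.trans hB3 (by
    rw [disjoint_insert_left, disjoint_union_left]
    exact ⟨hB1.1.1, hB1.2.symm, hB1.1.2.2.2.symm⟩)
    (Ne.symm hW2.1) hW2.2.1 hB1.1.2.2.1.1 (by
    simp only [mem_insert, mem_union, not_or]
    exact ⟨Ne.symm hW1.2.1, hA1.2.2.1.2.1, hS1.2.1⟩)
  refine ⟨_, ?_, ?_, T2⟩
  · simp only [disjoint_insert_left, disjoint_union_left]
    exact ⟨hW2.2.2, ⟨hW1.2.2, hA1.2.2.1.2.2, hS1.2.2⟩, hB1.1.2.2.1.2.2⟩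
  · have d1 := card_insert_le z₂ (insert z₁ (S1 ∪ S) ∪ S2)
    have d2 := card_union_le (insert z₁ (S1 ∪ S)) S2
    have d3 := card_insert_le z₁ (S1 ∪ S)
    have d4 := card_union_le S1 S
    omega

lemma Core.absorber {k n s t : ℕ} {F : SimpleGraph (Fin k)} {G : SimpleGraph (Fin n)}
    (C : Core F G s t) (Q : Finset (Fin n)) (hQ : Q.card = k)
    (W : Finset (Fin n)) (hW : W.card + k * k * s + 100 * (k * k * k) ≤ t) :
    ∃ A : Finset (Fin n), Disjoint A W ∧ A.card ≤ 11 * (k * k * k) ∧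
      Disjoint A Q ∧ PerfTilingOn F G A ∧ PerfTilingOn F G (A ∪ Q) := by
  classical
  obtain ⟨x, -⟩ := C.hxz
  have hk : 1 ≤ k := by have := x.2; omega
  have hkk : k ≤ k * k := by nlinarith
  have hkkk : k * k ≤ k * k * k := by nlinarith
  have c1 := card_union_le W Q
  obtain ⟨q, hq⟩ : Q.Nonempty := by rw [← card_pos]; omega
  obtain ⟨u, hu⟩ : (nb G q \ (W ∪ Q)).Nonempty := by
    rw [← card_pos]; have := le_card_sdiff (W ∪ Q) (nb G q); have := C.hD q; omega
  have huW := (mem_sdiff.1 hu).2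
  obtain ⟨f, hf1, hf2, hf3, hf4⟩ := star_embed C.degen C.hs C.hole x u (fun _ => nb G u) (W ∪ Q)
    (by intro y _; have := C.hD u; omega) (fun y _ v hv => mem_nb.1 hv)
  have hfW : ∀ i, f i ∉ W ∪ Q := by
    intro i
    by_cases hi : i = x
    · rw [hi, hf3]; exact huW
    · exact (hf4 i hi).2
  let e : Fin k → Fin n := fun i => ((Q.equivFinOfCardEq hQ).symm i : Fin n)
  have heinj : Function.Injective e := by
    intro i j hij
    exact (Q.equivFinOfCardEq hQ).symm.injective (Subtype.ext hij)
  have heQ : ∀ i, e i ∈ Q := fun i => ((Q.equivFinOfCardEq hQ).symm i).2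
  have hesurj : ∀ v ∈ Q, ∃ i, e i = v := by
    intro v hv
    exact ⟨Q.equivFinOfCardEq hQ ⟨v, hv⟩, by simp [e]⟩
  have c2 : (univ.image f).card ≤ k := by refine card_image_le.trans ?_; simp
  have c3 := card_union_le (W ∪ Q) (univ.image f)
  obtain ⟨E, hE1, hE2⟩ := greedy (univ : Finset (Fin k)) (fun i S => Sw F G (e i) (f i) S)
    (W ∪ Q ∪ univ.image f) (10 * (k * k)) (W.card + 2 * k + 10 * (k * k * k)) (by
      intro i _ W' hW'
      exact C.reach (e i) (f i) W' (by omega)) (by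
      simp only [card_univ, Fintype.card_fin]
      nlinarith)
  have hEn : ∀ i, ∀ v ∈ E i, v ∉ W ∧ v ∉ Q ∧ ∀ j, f j ≠ v := by
    intro i v hv
    have := disjoint_left.1 (hE1 i (mem_univ _)).1 hv
    simpa [not_or, and_assoc] using this
  have hfe : ∀ i j, f i ≠ e j := by
    intro i j h; apply hfW i; rw [h]; exact mem_union_right _ (heQ j)
  have hPA : PerfTilingOn F G (univ.biUnion (fun i => insert (f i) (E i))) := by
    apply perf_biUnion _ _ (fun i _ => (hE1 i (mem_univ _)).2.2.2.2.2)
    intro i _ j _ hij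
    simp only [disjoint_insert_left, disjoint_insert_right, mem_insert, not_or]
    exact ⟨⟨fun h => hij (hf1 h).symm, fun h => (hEn i _ h).2.2 j rfl⟩,
      fun h => (hEn j _ h).2.2 i rfl, hE2 i (mem_univ _) j (mem_univ _) hij⟩
  refine ⟨univ.biUnion (fun i => insert (f i) (E i)), ?_, ?_, ?_, hPA, ?_⟩
  · rw [disjoint_biUnion_left]
    intro i _
    rw [disjoint_insert_left]
    refine ⟨fun h => hfW i (mem_union_left _ h), ?_⟩
    rw [disjoint_left]; intro v hv; exact (hEn i v hv).1
  · have : (univ.biUnion (fun i => insert (f i) (E i))).card ≤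
        (univ : Finset (Fin k)).card * (10 * (k * k) + 1) := by
      apply card_biUnion_le_card_mul
      intro i _
      have h1 := card_insert_le (f i) (E i)
      have h2 := (hE1 i (mem_univ _)).2.1
      omega
    simp only [card_univ, Fintype.card_fin] at this
    nlinarith
  · rw [disjoint_biUnion_left]
    intro i _
    rw [disjoint_insert_left]
    refine ⟨fun h => hfW i (mem_union_right _ h), ?_⟩
    rw [disjoint_left]; intro v hv; exact (hEn i v hv).2.1
  · have P1 := half (g := e) hf1 hf2 univ E (fun i hi => (hE1 i hi).2.2.2.2.1)
      (fun i _ j _ hij h => hij (heinj h)) (fun i j _ => hfe i j)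
      (fun i j _ h => (hEn j _ h).2.2 i rfl) (fun i _ j _ h => (hEn j _ h).2.1 (heQ i)) hE2
    convert P1 using 1
    ext v
    simp only [mem_insert, mem_union, mem_image, mem_biUnion, mem_univ, true_and]
    constructor
    · rintro (⟨i, rfl | hv⟩ | hv)
      · exact Or.inl ⟨i, rfl⟩
      · exact Or.inr ⟨i, Or.inr hv⟩
      · obtain ⟨i, rfl⟩ := hesurj v hv
        exact Or.inr ⟨i, Or.inl rfl⟩
    · rintro (⟨i, rfl⟩ | ⟨i, rfl | hv⟩)
      · exact Or.inl ⟨i, Or.inl rfl⟩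
      · exact Or.inr (heQ i)
      · exact Or.inl ⟨i, Or.inr hv⟩

end RTT

open Finset

namespace RTT

lemma init_seg {V : Type*} [DecidableEq V] (idx : V → ℕ) (X : Finset V)
    (hinj : Set.InjOn idx X) (j : ℕ) (hj : j ≤ X.card) :
    ∃ Q ⊆ X, Q.card = j ∧ ∀ q ∈ Q, ∀ y ∈ X \ Q, idx q < idx y := by
  induction j with
  | zero => exact ⟨∅, by simp, by simp, by simp⟩
  | succ j ih =>
    obtain ⟨Q, hQ, hQc, hlt⟩ := ih (by omega)
    have hne : (X \ Q).Nonempty := by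
      rw [← card_pos]; have := le_card_sdiff Q X; omega
    obtain ⟨a, ha, hmin⟩ := exists_min_image (X \ Q) idx hne
    have ha' := mem_sdiff.1 ha
    refine ⟨insert a Q, insert_subset ha'.1 hQ, by rw [card_insert_of_notMem ha'.2, hQc], ?_⟩
    intro q hq y hy
    simp only [mem_sdiff, mem_insert, not_or] at hy
    have hyX : y ∈ X \ Q := mem_sdiff.2 ⟨hy.1, hy.2.2⟩
    rcases mem_insert.1 hq with rfl | hq
    · refine lt_of_le_of_ne (hmin y hyX) ?_
      intro h
      exact hy.2.1 (hinj (mem_coe.2 ha'.1) (mem_coe.2 hy.1) h).symm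
    · exact hlt q hq y hyX

lemma part {V : Type*} [DecidableEq V] (idx : V → ℕ) (k Wd : ℕ) (hk : 1 ≤ k) (m : ℕ) :
    ∀ X : Finset V, X.card = k * m → Set.InjOn idx X →
    (∀ x ∈ X, k ≤ (X.filter (fun y => idx x ≤ idx y ∧ idx y < idx x + Wd)).card ∨
      ∀ y ∈ X, idx x ≤ idx y → idx y < idx x + Wd) →
    ∃ P : Finset (Finset V), (∀ Q ∈ P, Q ⊆ X ∧ Q.card = k ∧
        ∃ x ∈ X, ∀ q ∈ Q, idx x ≤ idx q ∧ idx q < idx x + Wd) ∧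
      (∀ Q ∈ P, ∀ Q' ∈ P, Q ≠ Q' → Disjoint Q Q') ∧ P.biUnion id = X := by
  induction m with
  | zero =>
    intro X hX _ _
    have : X = ∅ := by rw [← card_eq_zero]; simpa using hX
    subst this
    exact ⟨∅, by simp, by simp, by simp⟩
  | succ m ih =>
    intro X hX hinj hwin
    have hXk : k ≤ X.card := by rw [hX]; nlinarith
    obtain ⟨Q, hQ, hQc, hlt⟩ := init_seg idx X hinj k hXk
    have hXne : X.Nonempty := by rw [← card_pos]; omega
    obtain ⟨x, hx, hmin⟩ := exists_min_image X idx hXne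
    have hQwin : ∀ q ∈ Q, idx x ≤ idx q ∧ idx q < idx x + Wd := by
      intro q hq
      refine ⟨hmin q (hQ hq), ?_⟩
      rcases hwin x hx with h | h
      · by_contra hcon
        rw [not_lt] at hcon
        have hsub : X.filter (fun y => idx x ≤ idx y ∧ idx y < idx x + Wd) ⊆ Q.erase q := by
          intro y hy
          rw [mem_filter] at hy
          rw [mem_erase]
          refine ⟨?_, ?_⟩
          · rintro rfl; omega
          · by_contra hyQ
            have := hlt q hq y (mem_sdiff.2 ⟨hy.1, hyQ⟩)
            omega
        have := card_le_card hsub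
        rw [card_erase_of_mem hq] at this
        omega
      · exact h q (hQ hq) (hmin q (hQ hq))
    have hc : (X \ Q).card = k * m := by
      rw [card_sdiff_of_subset hQ, hX, hQc, Nat.mul_succ]; omega
    obtain ⟨P, hP1, hP2, hP3⟩ := ih (X \ Q) hc
      (hinj.mono (by exact_mod_cast sdiff_subset)) (by
      intro y hy
      have hy' := mem_sdiff.1 hy
      rcases hwin y hy'.1 with h | h
      · left
        refine h.trans (card_le_card ?_)
        intro v hv
        rw [mem_filter] at hv ⊢
        refine ⟨mem_sdiff.2 ⟨hv.1, ?_⟩, hv.2⟩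
        intro hvQ
        have := hlt v hvQ y hy
        omega
      · right
        intro v hv
        exact h v (mem_sdiff.1 hv).1)
    refine ⟨insert Q P, ?_, ?_, ?_⟩
    · intro Q' hQ'
      rcases mem_insert.1 hQ' with rfl | hQ'
      · exact ⟨hQ, hQc, x, hx, hQwin⟩
      · obtain ⟨h1, h2, z, hz, h3⟩ := hP1 Q' hQ'
        exact ⟨h1.trans sdiff_subset, h2, z, (mem_sdiff.1 hz).1, h3⟩
    · intro Q' hQ' Q'' hQ'' hne
      rcases mem_insert.1 hQ' with h' | h' <;> rcases mem_insert.1 hQ'' with h'' | h''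
      · exact absurd (h'.trans h''.symm) hne
      · subst h'
        exact (disjoint_of_subset_left (hP1 Q'' h'').1 sdiff_disjoint).symm
      · subst h''
        exact disjoint_of_subset_left (hP1 Q' h').1 sdiff_disjoint
      · exact hP2 Q' h' Q'' h'' hne
    · rw [biUnion_insert, hP3]
      exact union_sdiff_of_subset hQ

lemma exists_idx {V : Type*} [DecidableEq V] (R : Finset V) :
    ∃ idx : V → ℕ, Set.InjOn idx R ∧ (∀ v ∈ R, idx v < R.card) ∧
      ∀ i < R.card, ∃ v ∈ R, idx v = i := by
  refine ⟨fun v => if h : v ∈ R then (R.equivFin ⟨v, h⟩ : ℕ) else 0, ?_, ?_, ?_⟩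
  · intro a ha b hb hab
    have ha' : a ∈ R := ha
    have hb' : b ∈ R := hb
    simp only [ha', hb', dif_pos] at hab
    have := R.equivFin.injective (Fin.ext hab)
    simpa using this
  · intro v hv
    simp only [hv, dif_pos]
    exact (R.equivFin ⟨v, hv⟩).2
  · intro i hi
    refine ⟨R.equivFin.symm ⟨i, hi⟩, (R.equivFin.symm ⟨i, hi⟩).2, ?_⟩
    simp

lemma card_range_le {V : Type*} [DecidableEq V] (idx : V → ℕ) (R S : Finset V) (hS : S ⊆ R)
    (hinj : Set.InjOn idx R) (i j : ℕ) (h : ∀ v ∈ S, i ≤ idx v ∧ idx v < i + j) :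
    S.card ≤ j := by
  have h1 : S.card = (S.image idx).card := by
    rw [card_image_of_injOn (hinj.mono (by exact_mod_cast hS))]
  have h2 : S.image idx ⊆ Ico i (i + j) := by
    intro a ha
    obtain ⟨v, hv, rfl⟩ := mem_image.1 ha
    exact mem_Ico.2 (h v hv)
  have := card_le_card h2
  rw [Nat.card_Ico] at this
  omega

lemma Core.cover {k n s t : ℕ} {F : SimpleGraph (Fin k)} {G : SimpleGraph (Fin n)}
    (C : Core F G s t) (R : Finset (Fin n)) (idx : Fin n → ℕ) (hinj : Set.InjOn idx R)
    (d u0 : ℕ) (hd : ∀ u, d ≤ (nb G u ∩ R).card)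
    (hu0 : u0 * (2 * k * k) * (2 * k) + k * k * s + 1 ≤ d) (U : Finset (Fin n))
    (hU : U.card ≤ u0) (hUR : Disjoint U R) :
    ∃ S : Fin n → Finset (Fin n), (∀ u ∈ U, S u ⊆ R ∧ (S u).card = k - 1 ∧
        SpansCopy F G (insert u (S u))) ∧
      ∀ u ∈ U, ∀ u' ∈ U, u ≠ u' → ∀ v ∈ S u, ∀ v' ∈ S u', idx v / (2 * k) ≠ idx v' / (2 * k) := by
  classical
  obtain ⟨x, -⟩ := C.hxz
  have hk : 1 ≤ k := by have := x.2; omega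
  let blk : Fin n → Finset (Fin n) := fun v => R.filter (fun w => idx w / (2 * k) = idx v / (2 * k))
  have hblk : ∀ v, (blk v).card ≤ 2 * k := by
    intro v
    apply card_range_le idx R _ (filter_subset _ _) hinj (2 * k * (idx v / (2 * k)))
    intro w hw
    have hw' := (mem_filter.1 hw).2
    rw [← hw']
    have h1 := Nat.div_add_mod (idx w) (2 * k)
    have h2 := Nat.mod_lt (idx w) (show 2 * k > 0 by omega)
    omega
  obtain ⟨T, hT1, hT2⟩ := greedy U (fun u T => ∃ S ⊆ R, S.card = k - 1 ∧
      SpansCopy F G (insert u S) ∧ T = S.biUnion blk) ∅ (2 * k * k) (u0 * (2 * k * k)) (by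
    intro u hu W hW
    have huR : u ∉ R := disjoint_left.1 hUR hu
    have hWc : (W.biUnion blk).card ≤ W.card * (2 * k) :=
      card_biUnion_le_card_mul _ _ _ (fun v _ => hblk v)
    obtain ⟨f, hf1, hf2, hf3, hf4⟩ := star_embed C.degen C.hs C.hole x u (fun _ => nb G u ∩ R)
      (W.biUnion blk) (by
        intro y _
        have := hd u
        have : W.card * (2 * k) ≤ u0 * (2 * k * k) * (2 * k) := Nat.mul_le_mul_right _ hW
        omega) (fun y _ v hv => mem_nb.1 (mem_inter.1 hv).1)
    have hSR : (univ.erase x).image f ⊆ R := by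
      intro v hv
      obtain ⟨y, hy, rfl⟩ := mem_image.1 hv
      exact (mem_inter.1 (hf4 y (ne_of_mem_erase hy)).1).2
    have hSc : ((univ.erase x).image f).card = k - 1 := by
      rw [card_image_of_injective _ hf1, card_erase_of_mem (mem_univ _)]; simp
    refine ⟨((univ.erase x).image f).biUnion blk, ?_, ?_, (univ.erase x).image f, hSR, hSc, ?_, rfl⟩
    · rw [disjoint_left]
      intro w hw hwW
      obtain ⟨v, hv, hwv⟩ := mem_biUnion.1 hw
      obtain ⟨y, hy, rfl⟩ := mem_image.1 hv
      apply (hf4 y (ne_of_mem_erase hy)).2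
      refine mem_biUnion.2 ⟨w, hwW, ?_⟩
      exact mem_filter.2 ⟨hSR hv, (mem_filter.1 hwv).2.symm⟩
    · refine (card_biUnion_le_card_mul _ _ _ (fun v _ => hblk v)).trans ?_
      rw [hSc]
      calc (k - 1) * (2 * k) ≤ k * (2 * k) := Nat.mul_le_mul_right _ (by omega)
        _ = 2 * k * k := by ring
    · refine ⟨f, hf1, hf2, ?_⟩
      rw [← hf3, ← image_insert, insert_erase (mem_univ _)]) (by
    simp only [card_empty, zero_add]
    exact Nat.mul_le_mul_right _ hU)
  have hex : ∀ u, ∃ S : Finset (Fin n), u ∈ U → (S ⊆ R ∧ S.card = k - 1 ∧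
      SpansCopy F G (insert u S) ∧ T u = S.biUnion blk) := by
    intro u
    by_cases hu : u ∈ U
    · obtain ⟨S, h1, h2, h3, h4⟩ := (hT1 u hu).2.2
      exact ⟨S, fun _ => ⟨h1, h2, h3, h4⟩⟩
    · exact ⟨∅, fun h => absurd h hu⟩
  choose S hS using hex
  refine ⟨S, fun u hu => ⟨(hS u hu).1, (hS u hu).2.1, (hS u hu).2.2.1⟩, ?_⟩
  intro u hu u' hu' hne v hv v' hv' heq
  have h1 : v ∈ T u := by
    rw [(hS u hu).2.2.2]
    exact mem_biUnion.2 ⟨v, hv, mem_filter.2 ⟨(hS u hu).1 hv, rfl⟩⟩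
  have h2 : v ∈ T u' := by
    rw [(hS u' hu').2.2.2]
    exact mem_biUnion.2 ⟨v', hv', mem_filter.2 ⟨(hS u hu).1 hv, heq⟩⟩
  exact disjoint_left.1 (hT2 u hu u' hu' hne) h1 h2

end RTT

open Finset

namespace RTT

/-- If the sets `S u` lie in different blocks, then every complete block keeps at least `k`
elements. -/
lemma block_keep {V : Type*} [DecidableEq V] (idx : V → ℕ) (k : ℕ) (hk : 1 ≤ k) (R U : Finset V)
    (hsurj : ∀ i < R.card, ∃ v ∈ R, idx v = i)
    (S : V → Finset V) (hS : ∀ u ∈ U, S u ⊆ R ∧ (S u).card = k - 1)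
    (hb : ∀ u ∈ U, ∀ u' ∈ U, u ≠ u' → ∀ v ∈ S u, ∀ v' ∈ S u', idx v / (2 * k) ≠ idx v' / (2 * k))
    (x : ℕ) (hx : x + 4 * k ≤ R.card) :
    k ≤ ((R \ U.biUnion S).filter (fun y => x ≤ idx y ∧ idx y < x + 4 * k)).card := by
  classical
  set b := x / (2 * k) + 1 with hbdef
  have h2k : 0 < 2 * k := by omega
  set B := R.filter (fun y => idx y / (2 * k) = b) with hB
  have hlow : x ≤ b * (2 * k) := by
    have := Nat.lt_div_mul_add h2k (a := x)
    rw [hbdef, add_mul]; omega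
  have hup : (b + 1) * (2 * k) ≤ x + 4 * k := by
    have := Nat.div_mul_le_self x (2 * k)
    rw [hbdef, add_mul, add_mul]; omega
  have hBwin : ∀ y ∈ B, x ≤ idx y ∧ idx y < x + 4 * k := by
    intro y hy
    have h := (mem_filter.1 hy).2
    have h1 := (Nat.div_eq_iff h2k).1 h
    have e : (b + 1) * (2 * k) = b * (2 * k) + 2 * k := by ring
    constructor <;> omega
  have hBcard : 2 * k ≤ B.card := by
    have hsub : (Finset.range (2 * k)).image (fun i => b * (2 * k) + i) ⊆ B.image idx := by
      intro i hi
      obtain ⟨j, hj, rfl⟩ := mem_image.1 hi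
      rw [mem_range] at hj
      have e : (b + 1) * (2 * k) = b * (2 * k) + 2 * k := by ring
      obtain ⟨v, hv, hvi⟩ := hsurj (b * (2 * k) + j) (by omega)
      refine mem_image.2 ⟨v, mem_filter.2 ⟨hv, ?_⟩, hvi⟩
      rw [hvi, mul_comm b, Nat.mul_add_div h2k, Nat.div_eq_of_lt hj, add_zero]
    have h1 := card_le_card hsub
    rw [card_image_of_injective _ (fun a b h => by simpa using h), card_range] at h1
    exact h1.trans card_image_le
  have hBD : (B ∩ U.biUnion S).card ≤ k - 1 := by
    rcases (B ∩ U.biUnion S).eq_empty_or_nonempty with h | ⟨v, hv⟩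
    · rw [h]; simp
    · obtain ⟨hvB, hvD⟩ := mem_inter.1 hv
      obtain ⟨u, hu, hvu⟩ := mem_biUnion.1 hvD
      rw [← (hS u hu).2]
      apply card_le_card
      intro w hw
      obtain ⟨hwB, hwD⟩ := mem_inter.1 hw
      obtain ⟨u', hu', hwu⟩ := mem_biUnion.1 hwD
      by_cases h : u = u'
      · rw [h]; exact hwu
      · exact absurd ((mem_filter.1 hvB).2.trans (mem_filter.1 hwB).2.symm)
          (hb u hu u' hu' h v hvu w hwu)
  have hsub : B \ U.biUnion S ⊆
      (R \ U.biUnion S).filter (fun y => x ≤ idx y ∧ idx y < x + 4 * k) := by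
    intro y hy
    obtain ⟨h1, h2⟩ := mem_sdiff.1 hy
    exact mem_filter.2 ⟨mem_sdiff.2 ⟨(mem_filter.1 h1).1, h2⟩, hBwin y h1⟩
  have h1 := card_le_card hsub
  have h2 := card_sdiff_add_card_inter B (U.biUnion S)
  omega

lemma Core.assemble {k n s t : ℕ} {F : SimpleGraph (Fin k)} {G : SimpleGraph (Fin n)}
    (C : Core F G s t) (hk : 1 ≤ k) (R : Finset (Fin n)) (d u0 : ℕ)
    (hd : ∀ u, d ≤ (nb G u ∩ R).card)
    (hu0 : u0 * (2 * k * k) * (2 * k) + k * k * s + 1 ≤ d)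
    (hbud : R.card + R.card * 2 ^ (4 * k) * (11 * (k * k * k)) + k * k * s + 100 * (k * k * k) ≤ t) :
    ∃ A : Finset (Fin n), A.card ≤ R.card + R.card * 2 ^ (4 * k) * (11 * (k * k * k)) ∧
      ∀ U, Disjoint U A → U.card ≤ u0 → k ∣ (A ∪ U).card → PerfTilingOn F G (A ∪ U) := by
  classical
  obtain ⟨idx, hinj, hlt, hsurj⟩ := exists_idx R
  let win : ℕ → Finset (Fin n) := fun i => R.filter (fun v => i ≤ idx v ∧ idx v < i + 4 * k)
  have hwin : ∀ i, (win i).card ≤ 4 * k := fun i =>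
    card_range_le idx R (win i) (filter_subset _ _) hinj i (4 * k)
      (fun v hv => (mem_filter.1 hv).2)
  let QQ : Finset (Finset (Fin n)) := (Finset.range R.card).biUnion (fun i => powersetCard k (win i))
  have hQQc : QQ.card ≤ R.card * 2 ^ (4 * k) := by
    refine card_biUnion_le.trans ?_
    refine (sum_le_card_nsmul _ _ (2 ^ (4 * k)) ?_).trans (by simp)
    intro i _
    rw [card_powersetCard]
    exact (Nat.choose_le_two_pow _ _).trans (Nat.pow_le_pow_right (by norm_num) (hwin i))
  have hQQ : ∀ Q ∈ QQ, Q ⊆ R ∧ Q.card = k := by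
    intro Q hQ
    obtain ⟨i, _, hi⟩ := mem_biUnion.1 hQ
    rw [mem_powersetCard] at hi
    exact ⟨hi.1.trans (filter_subset _ _), hi.2⟩
  obtain ⟨abs, habs, hdisj⟩ := greedy QQ
    (fun Q A => Disjoint A Q ∧ PerfTilingOn F G A ∧ PerfTilingOn F G (A ∪ Q)) R
    (11 * (k * k * k)) (R.card + R.card * 2 ^ (4 * k) * (11 * (k * k * k)))
    (by
      intro Q hQ W hW
      obtain ⟨A, h1, h2, h3⟩ := C.absorber Q (hQQ Q hQ).2 W (by omega)
      exact ⟨A, h1, h2, h3⟩)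
    (by gcongr)
  have hperf : PerfTilingOn F G (QQ.biUnion abs) :=
    perf_biUnion QQ abs (fun Q hQ => (habs Q hQ).2.2.2.1) hdisj
  have hRabs : Disjoint R (QQ.biUnion abs) := by
    rw [disjoint_biUnion_right]
    exact fun Q hQ => (habs Q hQ).1.symm
  refine ⟨R ∪ QQ.biUnion abs, ?_, ?_⟩
  · refine (card_union_le _ _).trans ?_
    gcongr
    refine card_biUnion_le.trans ?_
    refine (sum_le_card_nsmul _ _ (11 * (k * k * k)) (fun Q hQ => (habs Q hQ).2.1)).trans ?_
    rw [smul_eq_mul]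
    gcongr
  intro U hUA hUc hdvd
  rw [disjoint_union_right] at hUA
  obtain ⟨hUR, hUabs⟩ := hUA
  obtain ⟨S, hS, hSb⟩ := C.cover R idx hinj d u0 hd hu0 U hUc hUR
  have hSdisj : ∀ u ∈ U, ∀ u' ∈ U, u ≠ u' → Disjoint (S u) (S u') := by
    intro u hu u' hu' hne
    rw [Finset.disjoint_left]
    intro v hv hv'
    exact hSb u hu u' hu' hne v hv v hv' rfl
  set D := U.biUnion S with hD
  have hDR : D ⊆ R := biUnion_subset.2 (fun u hu => (hS u hu).1)
  have hDc : D.card = U.card * (k - 1) := by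
    rw [hD, card_biUnion hSdisj, sum_const_nat (fun u hu => (hS u hu).2.1)]
  set X := R \ D with hX
  have hXc : X.card + D.card = R.card := card_sdiff_add_card_eq_card hDR
  have hXd : k ∣ X.card := by
    rw [card_union_of_disjoint (disjoint_union_left.2 ⟨hUR.symm, hUabs.symm⟩),
      card_union_of_disjoint hRabs] at hdvd
    have h1 := perf_card hperf
    have h2 : X.card + k * U.card = R.card + U.card := by
      rw [← hXc, hDc]
      obtain ⟨m, rfl⟩ := Nat.exists_eq_add_of_le' hk
      simp; ring
    have h3 : k ∣ (X.card + k * U.card) + (QQ.biUnion abs).card := by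
      rw [h2]; convert hdvd using 1; ring
    have h4 := (Nat.dvd_add_left h1).1 h3
    exact (Nat.dvd_add_left (Dvd.intro _ rfl)).1 h4
  obtain ⟨m, hm⟩ := hXd
  obtain ⟨PP, hPP, hPPd, hPPX⟩ := part idx k (4 * k) hk m X hm
    (hinj.mono (coe_subset.2 sdiff_subset)) (by
      intro x hx
      by_cases hle : idx x + 4 * k ≤ R.card
      · left
        exact block_keep idx k hk R U hsurj S (fun u hu => ⟨(hS u hu).1, (hS u hu).2.1⟩)
          hSb (idx x) hle
      · right
        intro y hy _
        have := hlt y (mem_sdiff.1 hy).1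
        omega)
  have hPQ : PP ⊆ QQ := by
    intro Q hQ
    obtain ⟨h1, h2, x, hx, h3⟩ := hPP Q hQ
    refine mem_biUnion.2 ⟨idx x, mem_range.2 (hlt x (mem_sdiff.1 hx).1), ?_⟩
    rw [mem_powersetCard]
    exact ⟨fun q hq => mem_filter.2 ⟨(mem_sdiff.1 (h1 hq)).1, h3 q hq⟩, h2⟩
  have hA1 : PerfTilingOn F G (U.biUnion (fun u => insert u (S u))) := by
    refine perf_biUnion _ _ (fun u hu => perf_of_copy (hS u hu).2.2) ?_
    intro u hu u' hu' hne
    have a1 : u ∉ S u' := fun h => Finset.disjoint_left.1 hUR hu ((hS u' hu').1 h)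
    have a2 : u' ∉ S u := fun h => Finset.disjoint_left.1 hUR hu' ((hS u hu).1 h)
    rw [disjoint_insert_left, disjoint_insert_right]
    simp only [mem_insert, not_or]
    exact ⟨⟨hne, a1⟩, a2, hSdisj u hu u' hu' hne⟩
  let g : Finset (Fin n) → Finset (Fin n) := fun Q => if Q ∈ PP then abs Q ∪ Q else abs Q
  have hgsub : ∀ Q, g Q ⊆ abs Q ∪ Q := by
    intro Q; simp only [g]; split_ifs
    · rfl
    · exact subset_union_left
  have hA2 : PerfTilingOn F G (QQ.biUnion g) := by
    refine perf_biUnion _ _ ?_ ?_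
    · intro Q hQ
      simp only [g]
      split_ifs
      · exact (habs Q hQ).2.2.2.2
      · exact (habs Q hQ).2.2.2.1
    · intro Q hQ Q' hQ' hne
      have b0 := hdisj Q hQ Q' hQ' hne
      have b1 : Disjoint (abs Q) Q' := (habs Q hQ).1.mono_right (hQQ Q' hQ').1
      have b2 : Disjoint Q (abs Q') := ((habs Q' hQ').1.mono_right (hQQ Q hQ).1).symm
      simp only [g]
      split_ifs with h1 h2 h2
      · simp only [disjoint_union_left, disjoint_union_right]
        exact ⟨⟨b0, b2⟩, b1, hPPd Q h1 Q' h2 hne⟩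
      · simp only [disjoint_union_left]
        exact ⟨b0, b2⟩
      · simp only [disjoint_union_right]
        exact ⟨b0, b1⟩
      · exact b0
  have hgeq : QQ.biUnion g = QQ.biUnion abs ∪ X := by
    ext v
    simp only [mem_biUnion, mem_union]
    constructor
    · rintro ⟨Q, hQ, hv⟩
      simp only [g] at hv
      split_ifs at hv with h
      · rcases mem_union.1 hv with h' | h'
        · exact Or.inl ⟨Q, hQ, h'⟩
        · exact Or.inr ((hPP Q h).1 h')
      · exact Or.inl ⟨Q, hQ, hv⟩
    · rintro (⟨Q, hQ, hv⟩ | hv)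
      · refine ⟨Q, hQ, ?_⟩
        simp only [g]
        split_ifs
        · exact mem_union_left _ hv
        · exact hv
      · rw [← hPPX] at hv
        obtain ⟨Q, hQ, hv⟩ := mem_biUnion.1 hv
        refine ⟨Q, hPQ hQ, ?_⟩
        simp only [g, if_pos hQ]
        exact mem_union_right _ hv
  have hUeq : U.biUnion (fun u => insert u (S u)) = U ∪ D := by
    ext v
    simp only [mem_biUnion, mem_union, mem_insert, hD]
    constructor
    · rintro ⟨u, hu, rfl | h⟩
      · exact Or.inl hu
      · exact Or.inr ⟨u, hu, h⟩
    · rintro (h | ⟨u, hu, h⟩)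
      · exact ⟨v, h, Or.inl rfl⟩
      · exact ⟨u, hu, Or.inr h⟩
  have key := perf_union hA1 hA2 (by
    rw [hUeq, hgeq]
    simp only [disjoint_union_left, disjoint_union_right]
    exact ⟨⟨hUabs, hRabs.mono_left hDR⟩, hUR.mono_right sdiff_subset, disjoint_sdiff⟩)
  rw [hUeq, hgeq] at key
  convert key using 1
  rw [show R = D ∪ X from (union_sdiff_of_subset hDR).symm]
  ext v
  simp only [mem_union]
  tauto

end RTT

open Finset

namespace RTT

open Classical in
lemma dc {n : ℕ} (r : Fin n → Fin n → Prop) (Y : Finset (Fin n)) (p : ℝ) (t : ℕ)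
    (h : ∀ a ∈ Y, p ≤ ((univ.filter (fun z => r a z)).card : ℝ)) :
    p * Y.card ≤ n * ((univ.filter (fun z => t ≤ (Y.filter (fun a => r a z)).card)).card : ℝ)
      + n * t := by
  have h1 : p * Y.card ≤ ∑ a ∈ Y, ((univ.filter (fun z => r a z)).card : ℝ) := by
    have := card_nsmul_le_sum Y (fun a => ((univ.filter (fun z => r a z)).card : ℝ)) p h
    rw [nsmul_eq_mul] at this
    linarith
  have h2 : ∑ a ∈ Y, ((univ.filter (fun z => r a z)).card : ℝ)
      = ∑ z : Fin n, ((Y.filter (fun a => r a z)).card : ℝ) := by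
    exact_mod_cast sum_card_bipartiteAbove_eq_sum_card_bipartiteBelow (s := Y) (t := univ) r
  have h3 : ∑ z : Fin n, ((Y.filter (fun a => r a z)).card : ℝ) ≤
      ∑ z : Fin n, ((if t ≤ (Y.filter (fun a => r a z)).card then (n : ℝ) else 0) + t) := by
    refine sum_le_sum fun z _ => ?_
    split_ifs with hz
    · have : (Y.filter (fun a => r a z)).card ≤ n := by
        simpa using card_le_univ (Y.filter (fun a => r a z))
      have h' : ((Y.filter (fun a => r a z)).card : ℝ) ≤ n := by exact_mod_cast this
      have : (0 : ℝ) ≤ t := by positivity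
      linarith
    · rw [zero_add]
      exact_mod_cast (not_le.1 hz).le
  rw [sum_add_distrib, ← sum_filter, sum_const, sum_const, nsmul_eq_mul, nsmul_eq_mul] at h3
  simp only [card_univ, Fintype.card_fin] at h3
  linarith

lemma nb_ncard {n : ℕ} (G : SimpleGraph (Fin n)) (u : Fin n) :
    (G.neighborSet u).ncard = (nb G u).card := by
  rw [← Set.ncard_coe_finset]
  congr 1
  ext v
  simp [mem_nb]

lemma core_of {k n s : ℕ} {F : SimpleGraph (Fin k)} {G : SimpleGraph (Fin n)} (η : ℝ)
    (h0 : 0 < η) (h1 : η ≤ 1) (degen : Degen F) (hxz : ∃ x z : Fin k, x ≠ z ∧ ¬ F.Adj x z)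
    (hs : 1 ≤ s) (hole : NoHole G s) (hdeg : ∀ u, η * n ≤ ((nb G u).card : ℝ)) :
    Core F G s ⌊η ^ 3 / 4 * n⌋₊ := by
  classical
  set t := ⌊η ^ 3 / 4 * n⌋₊ with ht
  have htle : (t : ℝ) ≤ η ^ 3 / 4 * n := Nat.floor_le (by positivity)
  have hη2 : η ^ 2 ≤ 1 := by nlinarith
  have hη3 : η ^ 3 ≤ η ^ 2 := by nlinarith [sq_nonneg η]
  have hη31 : η ^ 3 ≤ η := by nlinarith
  have npos : ∀ u : Fin n, (0 : ℝ) < n := fun u => by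
    have := u.2
    exact_mod_cast (by omega : 0 < n)
  have hSim : ∀ u, η ^ 2 / 2 * n ≤ ((Sim G t u).card : ℝ) := by
    intro u
    have hn := npos u
    have := dc (fun a z => G.Adj a z) (nb G u) (η * n) t (fun a _ => by
      simpa [nb] using hdeg a)
    have e : (univ.filter (fun z => t ≤ ((nb G u).filter (fun a => G.Adj a z)).card)) = Sim G t u := by
      ext z
      simp only [Sim, mem_filter, mem_univ, true_and]
      rw [show (nb G u).filter (fun a => G.Adj a z) = nb G u ∩ nb G z from by
        ext w; simp [mem_nb, G.adj_comm]]
    rw [e] at this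
    have h2 : η * ((nb G u).card : ℝ) ≤ (Sim G t u).card + t := by
      have : (n : ℝ) * (η * ((nb G u).card : ℝ)) ≤ n * ((Sim G t u).card + t) := by linarith
      exact le_of_mul_le_mul_left this hn
    have h3 : η * (η * n) ≤ η * ((nb G u).card : ℝ) := by gcongr; exact hdeg u
    nlinarith
  have hYY : ∀ u, η ^ 3 / 4 * n ≤
      ((univ.filter (fun y => t ≤ (Sim G t y ∩ nb G u).card)).card : ℝ) := by
    intro u
    have hn := npos u
    have := dc (fun a z => z ∈ Sim G t a) (nb G u) (η ^ 2 / 2 * n) t (fun a _ => by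
      simpa using hSim a)
    have e : (univ.filter (fun z => t ≤ ((nb G u).filter (fun a => z ∈ Sim G t a)).card))
        = univ.filter (fun y => t ≤ (Sim G t y ∩ nb G u).card) := by
      ext z
      simp only [mem_filter, mem_univ, true_and]
      rw [show (nb G u).filter (fun a => z ∈ Sim G t a) = Sim G t z ∩ nb G u from by
        ext w
        simp only [mem_filter, mem_inter]
        exact ⟨fun h => ⟨sim_symm h.2, h.1⟩, fun h => ⟨h.2, sim_symm h.1⟩⟩]
    set Z := univ.filter (fun y => t ≤ (Sim G t y ∩ nb G u).card)
    replace this : η ^ 2 / 2 * n * ((nb G u).card : ℝ) ≤ n * (Z.card : ℝ) + n * t := by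
      rw [← e]
      convert this
    have h2 : η ^ 2 / 2 * ((nb G u).card : ℝ) ≤ Z.card + t := by
      have : (n : ℝ) * (η ^ 2 / 2 * ((nb G u).card : ℝ)) ≤ n * (Z.card + t) := by linarith
      exact le_of_mul_le_mul_left this hn
    have h3 : η ^ 2 / 2 * (η * n) ≤ η ^ 2 / 2 * ((nb G u).card : ℝ) := by gcongr; exact hdeg u
    nlinarith
  refine ⟨degen, hxz, hs, hole, fun u => ?_, fun u => ?_, fun u => ?_⟩
  · have := hdeg u
    have hn := npos u
    have : (t : ℝ) ≤ (nb G u).card := by nlinarith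
    exact_mod_cast this
  · have := hSim u
    have hn := npos u
    have : (t : ℝ) ≤ (Sim G t u).card := by nlinarith
    exact_mod_cast this
  · have : (t : ℝ) ≤ (univ.filter (fun y => t ≤ (Sim G t y ∩ nb G u).card)).card :=
      htle.trans (hYY u)
    have h' := Nat.cast_le.1 this
    convert h'

end RTT

open Finset

namespace RTT

lemma colour_sum (n q : ℕ) (T : Finset (Fin n)) (j : Fin q) :
    ∑ ω : Fin n → Fin q, (1 / 2 : ℝ) ^ (T.filter (fun v => ω v = j)).card
      = (q : ℝ) ^ n * (1 - 1 / (2 * q)) ^ T.card := by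
  classical
  have hq : (q : ℝ) ≠ 0 := by
    have := j.2
    exact_mod_cast (by omega : q ≠ 0)
  have h1 : ∀ ω : Fin n → Fin q, (1 / 2 : ℝ) ^ (T.filter (fun v => ω v = j)).card
      = ∏ v : Fin n, (if v ∈ T ∧ ω v = j then (1 / 2 : ℝ) else 1) := by
    intro ω
    rw [prod_ite, prod_const_one, mul_one, prod_const]
    congr 2
    ext v; simp
  simp_rw [h1]
  have h2 := Finset.prod_univ_sum (fun _ : Fin n => (univ : Finset (Fin q)))
    (fun v c => if v ∈ T ∧ c = j then (1 / 2 : ℝ) else 1)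
  rw [Fintype.piFinset_univ] at h2
  rw [← h2]
  have h3 : ∀ v : Fin n, ∑ c : Fin q, (if v ∈ T ∧ c = j then (1 / 2 : ℝ) else 1)
      = q * (if v ∈ T then (1 - 1 / (2 * q) : ℝ) else 1) := by
    intro v
    by_cases hv : v ∈ T
    · simp only [hv, true_and, if_true]
      have : ∀ c : Fin q, (if c = j then (1 / 2 : ℝ) else 1) = 1 - (if c = j then 1 / 2 else 0) := by
        intro c; split_ifs <;> norm_num
      simp_rw [this]
      rw [sum_sub_distrib, sum_ite_eq']
      simp
      field_simp
    · simp [hv]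
  simp_rw [h3]
  rw [prod_mul_distrib, prod_const, prod_ite, prod_const_one, mul_one, prod_const]
  simp

lemma random_set (η : ℝ) (hη : 0 < η) (q : ℕ) (hq : 1 ≤ q) :
    ∃ c : ℝ, 0 < c ∧ ∃ N : ℕ, ∀ n : ℕ, N ≤ n → ∀ Nb : Fin n → Finset (Fin n),
      (∀ u, η * n ≤ ((Nb u).card : ℝ)) →
      ∃ R : Finset (Fin n), q * R.card ≤ n ∧ ∀ u, c * n ≤ ((Nb u ∩ R).card : ℝ) := by
  classical
  have hq1 : (1 : ℝ) ≤ q := by exact_mod_cast hq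
  set a : ℝ := 1 - 1 / (2 * q) with ha
  have ha0 : 0 < a := by
    rw [ha, sub_pos, div_lt_one (by positivity)]; linarith
  have ha1 : a < 1 := by
    rw [ha]; have : (0 : ℝ) < 1 / (2 * q) := by positivity
    linarith
  set b : ℝ := a ^ (η / 2) with hb
  have hb0 : 0 < b := Real.rpow_pos_of_pos ha0 _
  have hb1 : b < 1 := Real.rpow_lt_one ha0.le ha1 (by positivity)
  set c : ℝ := - Real.log b / Real.log 2 with hc
  have hl2 : 0 < Real.log 2 := Real.log_pos (by norm_num)
  have hc0 : 0 < c := div_pos (by linarith [Real.log_neg hb0 hb1]) hl2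
  have hcb : ((1 / 2 : ℝ)) ^ c = b := by
    rw [Real.rpow_def_of_pos (by norm_num), one_div, Real.log_inv, hc]
    rw [show -Real.log 2 * (-Real.log b / Real.log 2) = Real.log b by field_simp]
    exact Real.exp_log hb0
  have hlim : Filter.Tendsto (fun n : ℕ => (n : ℝ) * b ^ n) Filter.atTop (nhds 0) :=
    tendsto_self_mul_const_pow_of_lt_one hb0.le hb1
  have hev := hlim.eventually (gt_mem_nhds (show (0 : ℝ) < 1 / q by positivity))
  obtain ⟨N, hN⟩ := Filter.eventually_atTop.1 hev
  refine ⟨c, hc0, N, fun n hn Nb hNb => ?_⟩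
  have hsmall : (n : ℝ) * b ^ n * q < 1 := by
    have := hN n hn
    rwa [lt_div_iff₀ (by positivity)] at this
  have hex : ∃ ω : Fin n → Fin q, ∀ u j,
      c * n ≤ (((Nb u).filter (fun v => ω v = j)).card : ℝ) := by
    by_contra hcon
    push Not at hcon
    have hlow : ∀ ω : Fin n → Fin q, b ^ n ≤
        ∑ u : Fin n, ∑ j : Fin q, (1 / 2 : ℝ) ^ ((Nb u).filter (fun v => ω v = j)).card := by
      intro ω
      obtain ⟨u, j, huj⟩ := hcon ω
      have e1 : b ^ n ≤ (1 / 2 : ℝ) ^ ((Nb u).filter (fun v => ω v = j)).card := by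
        rw [← hcb, ← Real.rpow_natCast, ← Real.rpow_mul (by norm_num), ← Real.rpow_natCast]
        exact Real.rpow_le_rpow_of_exponent_ge (by norm_num) (by norm_num) huj.le
      refine e1.trans ?_
      refine le_trans ?_ (single_le_sum (f := fun u => ∑ j : Fin q,
        (1 / 2 : ℝ) ^ ((Nb u).filter (fun v => ω v = j)).card)
        (fun i _ => by positivity) (mem_univ u))
      exact single_le_sum (f := fun j : Fin q =>
        (1 / 2 : ℝ) ^ ((Nb u).filter (fun v => ω v = j)).card)
        (fun i _ => by positivity) (mem_univ j)
    have hsum := sum_le_sum (fun ω (_ : ω ∈ (univ : Finset (Fin n → Fin q))) => hlow ω)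
    rw [sum_const, sum_comm, nsmul_eq_mul] at hsum
    have hup : ∑ u : Fin n, ∑ ω : Fin n → Fin q, ∑ j : Fin q,
        (1 / 2 : ℝ) ^ ((Nb u).filter (fun v => ω v = j)).card
        ≤ ∑ u : Fin n, ∑ j : Fin q, (q : ℝ) ^ n * (b ^ n * b ^ n) := by
      refine sum_le_sum fun u _ => ?_
      rw [sum_comm]
      refine sum_le_sum fun j _ => ?_
      rw [colour_sum]
      gcongr
      rw [← pow_add, hb, ← Real.rpow_natCast, ← Real.rpow_natCast, ← Real.rpow_mul ha0.le]
      refine Real.rpow_le_rpow_of_exponent_ge ha0 ha1.le ?_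
      refine le_trans (le_of_eq ?_) (hNb u)
      push_cast; ring
    have := hsum.trans hup
    simp only [sum_const, card_univ, Fintype.card_fin, nsmul_eq_mul, Fintype.card_pi,
      prod_const] at this
    push_cast at this
    have hpos : 0 < (q : ℝ) ^ n * b ^ n := by positivity
    have h2 : (q : ℝ) ^ n * b ^ n * 1 ≤ (q : ℝ) ^ n * b ^ n * (n * b ^ n * q) := by
      calc _ = (q : ℝ) ^ n * b ^ n := by ring
        _ ≤ _ := this
        _ = _ := by ring
    have h3 := le_of_mul_le_mul_left h2 hpos
    linarith
  obtain ⟨ω, hω⟩ := hex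
  have hcl : ∃ j : Fin q, q * (univ.filter (fun v => ω v = j)).card ≤ n := by
    by_contra hcon
    push Not at hcon
    have h1 : ∑ j : Fin q, (univ.filter (fun v => ω v = j)).card = n := by
      rw [← card_eq_sum_card_fiberwise (f := ω) (s := univ) (t := univ) (by simp)]
      simp
    have h2 : ∑ j : Fin q, n < ∑ j : Fin q, q * (univ.filter (fun v => ω v = j)).card :=
      sum_lt_sum_of_nonempty ⟨⟨0, hq⟩, mem_univ _⟩ (fun j _ => hcon j)
    rw [← mul_sum, h1] at h2
    simp at h2
  obtain ⟨j, hj⟩ := hcl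
  refine ⟨_, hj, fun u => ?_⟩
  convert hω u j using 3
  ext v; simp

end RTT

open RTT in
/-- Fix `k ≥ 3`, a `k`-vertex graph `F` and `η > 0` such that `F` is a tree,
or `F = C_k` with `k ≥ 4` and `η ≥ 1/k`. Then for any `γ, μ > 0` there are `α, ξ > 0`
such that for all sufficiently large `n`, every `n`-vertex graph `G` with
`δ(G) ≥ (η+μ)n` and `α*(G) ≤ αn` contains a `ξ`-absorbing set of size at most `γn`. -/
theorem absorbing_set_bipartite_holes :
    ∀ k : ℕ, 3 ≤ k → ∀ F : SimpleGraph (Fin k), ∀ η : ℝ, 0 < η →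
    (F.IsTree ∨ (4 ≤ k ∧ F = SimpleGraph.cycleGraph k ∧ 1 / (k : ℝ) ≤ η)) →
    ∀ γ μ : ℝ, 0 < γ → 0 < μ →
    ∃ α ξ : ℝ, 0 < α ∧ 0 < ξ ∧ ∃ N : ℕ, ∀ n : ℕ, N ≤ n →
      ∀ G : SimpleGraph (Fin n),
        MinDegGE G ((η + μ) * n) → HoleBound G (α * n) →
        ∃ A : Finset (Fin n), (A.card : ℝ) ≤ γ * n ∧
          IsAbsorbingSet F G ξ Finset.univ A := by
  intro k hk F η hη hF γ μ hγ hμ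
  obtain ⟨hdegen, hxz⟩ := good_of_hyp hk (F := F)
    (hF.imp id (fun h => ⟨h.1, h.2.1⟩))
  set e : ℝ := min η 1 with he
  have he0 : 0 < e := lt_min hη one_pos
  have he1 : e ≤ 1 := min_le_right _ _
  have heη : e ≤ η := min_le_left _ _
  set c : ℝ := e ^ 3 / 4 with hc
  have hc0 : 0 < c := by positivity
  have hkR : (3 : ℝ) ≤ k := by exact_mod_cast hk
  have hk0 : (0 : ℝ) < k := by linarith
  set B : ℝ := 1 + 2 ^ (4 * k) * (11 * (k * k * k)) with hB
  have hB0 : 0 < B := by positivity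
  set ρ : ℝ := min γ (c / 4) / B with hρ
  have hρ0 : 0 < ρ := div_pos (lt_min hγ (by positivity)) hB0
  have hBρ : B * ρ = min γ (c / 4) := by rw [hρ]; field_simp
  have hBγ : B * ρ ≤ γ := hBρ ▸ min_le_left _ _
  have hBc : B * ρ ≤ c / 4 := hBρ ▸ min_le_right _ _
  set q : ℕ := ⌈1 / ρ⌉₊ + 1 with hq
  have hqρ : 1 ≤ ρ * q := by
    have h1 : 1 / ρ ≤ q := (Nat.le_ceil _).trans (by rw [hq]; push_cast; linarith)
    rw [div_le_iff₀ hρ0] at h1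
    linarith
  obtain ⟨cR, hcR0, N1, hN1⟩ := random_set e he0 q (by omega)
  set m : ℝ := min c cR with hm
  have hm0 : 0 < m := lt_min hc0 hcR0
  have hmc : m ≤ c := min_le_left _ _
  have hmR : m ≤ cR := min_le_right _ _
  set M0 : ℝ := k * k + 100 * (k * k * k) + 3 with hM0
  set α : ℝ := m / (8 * (k * k)) with hα
  set ξ : ℝ := cR / (32 * (k * k * k)) with hξ
  have hα0 : 0 < α := by positivity
  have hξ0 : 0 < ξ := by positivity
  have hkα : k * k * α = m / 8 := by rw [hα]; field_simp
  have hkξ : 4 * (k * k * k) * ξ = cR / 8 := by rw [hξ]; field_simp; norm_num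
  refine ⟨α, ξ, hα0, hξ0, max N1 ⌈2 * M0 / m⌉₊, fun n hn G hdeg hhole => ?_⟩
  have hn1 : N1 ≤ n := (le_max_left _ _).trans hn
  have hnm : 2 * M0 ≤ m * n := by
    have h1 : 2 * M0 / m ≤ n :=
      (Nat.le_ceil _).trans (by exact_mod_cast (le_max_right _ _).trans hn)
    rw [div_le_iff₀ hm0] at h1
    linarith
  have hn0 : (0 : ℝ) ≤ n := by positivity
  have hmcn : m * n ≤ c * n := by gcongr
  have hmRn : m * n ≤ cR * n := by gcongr
  have hkk : (0 : ℝ) ≤ k * k := by positivity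
  have hkkk : (0 : ℝ) ≤ k * k * k := by positivity
  have hdeg' : ∀ u, e * n ≤ ((nb G u).card : ℝ) := by
    intro u
    have h1 := hdeg u
    rw [nb_ncard] at h1
    refine le_trans ?_ h1
    gcongr
    linarith
  set s : ℕ := ⌊α * n⌋₊ + 1 with hs
  have hsle : (s : ℝ) ≤ α * n + 1 := by
    rw [hs]; push_cast
    have := Nat.floor_le (show 0 ≤ α * n by positivity)
    linarith
  have hks : (k : ℝ) * k * s ≤ m * n / 8 + k * k := by
    have : (k : ℝ) * k * s ≤ k * k * (α * n + 1) := by gcongr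
    have h2 : (k : ℝ) * k * (α * n + 1) = k * k * α * n + k * k := by ring
    rw [h2, hkα] at this
    linarith
  have hole : NoHole G s := noHole_of_bound hhole (by
    rw [hs]; push_cast; exact Nat.lt_floor_add_one _)
  have C := core_of e he0 he1 hdegen hxz (by omega : 1 ≤ s) hole hdeg'
  rw [← hc] at C
  obtain ⟨R, hR, hRd⟩ := hN1 n hn1 (nb G) hdeg'
  have hRρ : (R.card : ℝ) ≤ ρ * n := by
    have h1 : (q : ℝ) * R.card ≤ n := by exact_mod_cast hR
    have h2 : ρ * (q * R.card) ≤ ρ * n := by gcongr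
    have h3 : 1 * (R.card : ℝ) ≤ ρ * q * R.card := by gcongr
    linarith
  have hBR : B * R.card ≤ B * ρ * n := by
    rw [mul_assoc]; gcongr
  have hBRe : (R.card : ℝ) + R.card * 2 ^ (4 * k) * (11 * (k * k * k)) = B * R.card := by
    rw [hB]; ring
  have hBRc : B * R.card ≤ c / 4 * n := hBR.trans (by gcongr)
  have hBRγ : B * R.card ≤ γ * n := hBR.trans (by gcongr)
  obtain ⟨A, hAc, hA⟩ := C.assemble (by omega) R ⌊cR * n⌋₊ ⌊ξ * n⌋₊
    (fun u => Nat.floor_le_of_le (hRd u))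
    (by
      apply Nat.le_floor
      push_cast
      have h1 := Nat.floor_le (show 0 ≤ ξ * n by positivity)
      have h2 : (⌊ξ * n⌋₊ : ℝ) * (2 * k * k) * (2 * k) ≤ cR / 8 * n := by
        calc (⌊ξ * n⌋₊ : ℝ) * (2 * k * k) * (2 * k) ≤ ξ * n * (2 * k * k) * (2 * k) := by gcongr
          _ = 4 * (k * k * k) * ξ * n := by ring
          _ = _ := by rw [hkξ]
      linarith)
    (by
      apply Nat.le_floor
      push_cast
      linarith)
  refine ⟨A, ?_, ?_⟩
  · have h1 : (A.card : ℝ) ≤ R.card + R.card * 2 ^ (4 * k) * (11 * (k * k * k)) := by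
      exact_mod_cast hAc
    linarith
  · intro U hU hUc hdvd
    refine hA U ?_ (Nat.le_floor hUc) hdvd
    rw [Finset.disjoint_left]
    intro v hv
    exact (Finset.mem_sdiff.1 (hU hv)).2
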